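/- arXiv:1801.02957 — 3 statements merged into one kernel-verified Lean document; each statement's English description precedes it below -/
import Mathlib

section
/- Let A, B ∈ ℤ with 0 < A ≤ B, B ≥ 2, 2A − B = 3 and A ≠ B, let M = [[0, −B], [1, −A]] acting on ℝ², and let T be the tile for M and digits {0, …, B−1}·e₁. For digits a₁, a₂, a₃, a₁', a₂', a₃' ∈ {0, …, B−1} with a₁ − a₁' = 1 and a₂ − a₂' = A−2, the subdivision pieces T_{a₁a₂a₃} and T_{a₁'a₂'a₃'} have nonempty intersection if and only if a₃ − a₃' = −1; and in that case the intersection is the singleton { M⁻¹·(a₁·e₁) + M⁻²·(a₂·e₁) + M⁻³·(a₃·e₁) + (B−1)·Σ_{k≥0} M^{−(5+2k)}·e₁ } (the point with digit expansion 0.a₁a₂a₃ followed by the periodic tail 0,(B−1),0,(B−1),…). -/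
noncomputable section

/-- The matrix `[[0, -B], [1, -A]]` as a real matrix. -/
def M' (A B : ℤ) : Matrix (Fin 2) (Fin 2) ℝ := !![0, -(B : ℝ); 1, -(A : ℝ)]

/-- `e₁ = (1, 0) ∈ ℝ²`. -/
def e1 : Fin 2 → ℝ := ![1, 0]

/-- The subdivision piece `T_{a₁…a_m} = M⁻¹(a₁e₁) + ⋯ + M^{-m}(a_m e₁) + M^{-m}·T`. -/
def subPiece (A B : ℤ) (T : Set (Fin 2 → ℝ)) {m : ℕ} (a : Fin m → ℤ) :
    Set (Fin 2 → ℝ) :=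
  (fun x => (∑ i : Fin m, ((M' A B)⁻¹ ^ ((i : ℕ) + 1)).mulVec ((a i : ℝ) • e1))
    + ((M' A B)⁻¹ ^ m).mulVec x) '' T

/-- The point with digit expansion `0.a₁a₂a₃` followed by the periodic tail
`0, (B-1), 0, (B-1), …`. -/
def ptTail (A B : ℤ) (a₁ a₂ a₃ : ℤ) : Fin 2 → ℝ :=
  ((M' A B)⁻¹ ^ 1).mulVec ((a₁ : ℝ) • e1) + ((M' A B)⁻¹ ^ 2).mulVec ((a₂ : ℝ) • e1)
    + ((M' A B)⁻¹ ^ 3).mulVec ((a₃ : ℝ) • e1)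
    + ((B : ℝ) - 1) • ∑' k : ℕ, ((M' A B)⁻¹ ^ (5 + 2 * k)).mulVec e1

namespace TileTail

open Filter Topology Matrix

attribute [local instance] Matrix.linftyOpNormedAddCommGroup Matrix.linftyOpNormedSpace

/-- A bounded integer sequence which almost satisfies the recurrence with characteristic
polynomial `x² + A x + (2 A - 3)` takes values in `[-2, 2]`. -/
lemma abs_le_two_of_bounded {A : ℤ} (hA : 4 ≤ A) {y : ℕ → ℤ} {C : ℤ} (hC : ∀ n, |y n| ≤ C)
    (hy : ∀ n, |y (n + 2) + A * y (n + 1) + (2 * A - 3) * y n| ≤ 2 * A - 4) (n : ℕ) :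
    |y n| ≤ 2 := by
  obtain ⟨K, ⟨m, hm⟩, hmax⟩ := Int.exists_greatest_of_bdd (P := fun k => ∃ n, |y n| = k)
    ⟨C, by rintro _ ⟨n, rfl⟩; exact hC n⟩ ⟨_, 0, rfl⟩
  have hK : ∀ n, |y n| ≤ K := fun n => hmax _ ⟨n, rfl⟩
  refine (hK n).trans ?_
  by_contra! hlt
  set E : ℕ → ℤ := fun n => y (n + 2) + A * y (n + 1) + (2 * A - 3) * y n with hE
  have key : (2 * A - 3) ^ 2 * y m =
      E (m + 2) + -A * E (m + 1) + (2 * A - 3) * E m + (A ^ 2 - 4 * A + 6) * y (m + 2)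
        + -y (m + 4) := by
    simp only [hE]
    ring
  have hQ : 0 ≤ A ^ 2 - 4 * A + 6 := by nlinarith
  have h1 : (2 * A - 3) ^ 2 * K ≤ (2 * A - 4) + A * (2 * A - 4) + (2 * A - 3) * (2 * A - 4)
      + (A ^ 2 - 4 * A + 6) * K + K := by
    calc (2 * A - 3) ^ 2 * K = |(2 * A - 3) ^ 2 * y m| := by
          rw [abs_mul, hm, abs_of_nonneg (sq_nonneg _)]
      _ ≤ |E (m + 2)| + |-A * E (m + 1)| + |(2 * A - 3) * E m|
          + |(A ^ 2 - 4 * A + 6) * y (m + 2)| + |-y (m + 4)| := by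
          rw [key]
          refine (abs_add_le _ _).trans (add_le_add_left ?_ _)
          refine (abs_add_le _ _).trans (add_le_add_left ?_ _)
          refine (abs_add_le _ _).trans (add_le_add_left ?_ _)
          exact abs_add_le _ _
      _ ≤ _ := by
          rw [abs_mul, abs_mul, abs_mul, abs_neg, abs_neg, abs_of_nonneg hQ,
            abs_of_nonneg (show 0 ≤ A by linarith),
            abs_of_nonneg (show 0 ≤ 2 * A - 3 by linarith)]
          have h := hy m
          have h' := hy (m + 1)
          have h'' := hy (m + 2)
          have := hK (m + 2)
          have := hK (m + 4)
          gcongr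
          linarith
  nlinarith [mul_nonneg (show 0 ≤ 3 * A ^ 2 - 8 * A + 2 by nlinarith) (show 0 ≤ K - 3 by linarith)]

/-- Under the hypotheses of `abs_le_two_of_bounded`, the value `±2` is followed by `∓2`. -/
lemma eq_two_mul_neg_one_pow {A : ℤ} (hA : 4 ≤ A) {y : ℕ → ℤ} {C : ℤ} (hC : ∀ n, |y n| ≤ C)
    (hy : ∀ n, |y (n + 2) + A * y (n + 1) + (2 * A - 3) * y n| ≤ 2 * A - 4)
    (h0 : y 0 = -2) (n : ℕ) : y (2 * n) = -2 ∧ y (2 * n + 1) = 2 := by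
  have hb := fun n => abs_le.1 (abs_le_two_of_bounded hA hC hy n)
  have hneg : ∀ n, y n = -2 → y (n + 1) = 2 := by
    intro n hn
    have h1 := (abs_le.1 (hy n)).1
    have h2 := hb (n + 1)
    have h3 := hb (n + 2)
    rw [hn] at h1
    by_contra hne
    have h4 : y (n + 1) ≤ 1 := by omega
    have h5 := abs_le.1 (hy (n + 1))
    have h6 := hb (n + 1 + 2)
    nlinarith
  have hpos : ∀ n, y n = 2 → y (n + 1) = -2 := by
    intro n hn
    have h1 := (abs_le.1 (hy n)).2
    have h2 := hb (n + 1)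
    have h3 := hb (n + 2)
    rw [hn] at h1
    by_contra hne
    have h4 : -1 ≤ y (n + 1) := by omega
    have h5 := abs_le.1 (hy (n + 1))
    have h6 := hb (n + 1 + 2)
    nlinarith
  induction n with
  | zero => exact ⟨h0, hneg 0 h0⟩
  | succ n ih =>
    have h : y (2 * (n + 1)) = -2 := hpos _ ih.2
    exact ⟨h, hneg _ h⟩

/-- Geometric decay for a second-order linear recurrence whose characteristic roots have modulus
at most `1 / 2`. -/
lemma exists_norm_le_geometric {E : Type*} [NormedAddCommGroup E] [NormedSpace ℝ E] {v : ℕ → E}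
    {b q : ℝ} (hb : 0 < b) (hq : 0 ≤ q) (hbq : 2 * q + 4 ≤ b)
    (hv : ∀ n, b • v (n + 2) = q • v (n + 1) - v n) :
    ∃ C, ∀ n, ‖v n‖ ≤ C * (1 / 2) ^ n := by
  refine ⟨‖v 0‖ + 2 * ‖v 1‖, fun n => ?_⟩
  set C := ‖v 0‖ + 2 * ‖v 1‖ with hC
  have hC0 : 0 ≤ C := by positivity
  suffices h : ‖v n‖ ≤ C * (1 / 2) ^ n ∧ ‖v (n + 1)‖ ≤ C * (1 / 2) ^ (n + 1) from h.1
  induction n with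
  | zero =>
    have := norm_nonneg (v 0)
    have := norm_nonneg (v 1)
    constructor <;> norm_num <;> linarith
  | succ n ih =>
    refine ⟨ih.2, ?_⟩
    have h1 : b * ‖v (n + 2)‖ ≤ q * ‖v (n + 1)‖ + ‖v n‖ := by
      have := norm_sub_le (q • v (n + 1)) (v n)
      rwa [← hv, norm_smul, norm_smul, Real.norm_of_nonneg hb.le, Real.norm_of_nonneg hq] at this
    have hD : 0 ≤ C * (1 / 2) ^ n := by positivity
    have h2 : b * ‖v (n + 2)‖ ≤ b * (C * (1 / 2) ^ (n + 1 + 1)) := by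
      have h3 := mul_le_mul_of_nonneg_left ih.2 hq
      have h4 := mul_le_mul_of_nonneg_right hbq hD
      rw [pow_succ] at h3 ⊢
      rw [pow_succ]
      linarith [ih.1]
    exact le_of_mul_le_mul_left h2 hb

lemma inv_M' {A B : ℤ} (hB : 2 ≤ B) :
    (M' A B)⁻¹ = !![-(A : ℝ) / B, 1; -1 / B, 0] := by
  have hB' : (B : ℝ) ≠ 0 := by exact_mod_cast (by omega : B ≠ 0)
  refine Matrix.inv_eq_right_inv ?_
  ext i j
  fin_cases i <;> fin_cases j <;> simp [M', Matrix.mul_apply]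
  field_simp
  ring

lemma isUnit_det_M' {A B : ℤ} (hB : 2 ≤ B) : IsUnit (M' A B).det := by
  have hB' : (B : ℝ) ≠ 0 := by exact_mod_cast (by omega : B ≠ 0)
  simp [M', Matrix.det_fin_two, hB']

lemma inv_mulVec_mulVec {A B : ℤ} (hB : 2 ≤ B) (x : Fin 2 → ℝ) :
    (M' A B)⁻¹ *ᵥ (M' A B *ᵥ x) = x := by
  rw [Matrix.mulVec_mulVec, Matrix.nonsing_inv_mul _ (isUnit_det_M' hB), Matrix.one_mulVec]

lemma mulVec_inv_mulVec {A B : ℤ} (hB : 2 ≤ B) (x : Fin 2 → ℝ) :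
    M' A B *ᵥ ((M' A B)⁻¹ *ᵥ x) = x := by
  rw [Matrix.mulVec_mulVec, Matrix.mul_nonsing_inv _ (isUnit_det_M' hB), Matrix.one_mulVec]

lemma inv_pow_mulVec_injective {A B : ℤ} (hB : 2 ≤ B) (m : ℕ) :
    Function.Injective fun x : Fin 2 → ℝ => ((M' A B)⁻¹ ^ m) *ᵥ x := by
  intro x y hxy
  have h : M' A B ^ m * (M' A B)⁻¹ ^ m = 1 := by
    rw [Matrix.inv_pow', Matrix.mul_nonsing_inv]
    rw [Matrix.det_pow]
    exact (isUnit_det_M' hB).pow m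
  have := congrArg (fun v => (M' A B ^ m) *ᵥ v) hxy
  simpa only [Matrix.mulVec_mulVec, h, Matrix.one_mulVec] using this

/-- The even powers of `M⁻¹` decay geometrically. -/
lemma exists_norm_inv_sq_pow_le {A B : ℤ} (hA : 4 ≤ A) (h3 : B = 2 * A - 3) :
    ∃ C, ∀ n, ‖((M' A B)⁻¹ ^ 2) ^ n‖ ≤ C * (1 / 2) ^ n := by
  have hB : 2 ≤ B := by omega
  have hA' : (4 : ℝ) ≤ A := by exact_mod_cast hA
  have hB' : (B : ℝ) = 2 * A - 3 := by exact_mod_cast h3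
  have hB0 : (2 * A - 3 : ℝ) ≠ 0 := by linarith
  refine exists_norm_le_geometric (b := (B : ℝ) ^ 2) (q := (A : ℝ) ^ 2 - 2 * B)
    (by rw [hB']; nlinarith) (by rw [hB']; nlinarith) (by rw [hB']; nlinarith) fun n => ?_
  have h : (B : ℝ) ^ 2 • ((M' A B)⁻¹ ^ 2) ^ 2 =
      ((A : ℝ) ^ 2 - 2 * B) • (M' A B)⁻¹ ^ 2 - 1 := by
    rw [inv_M' hB, hB']
    ext i j
    fin_cases i <;> fin_cases j <;>
      simp [pow_two] <;> field_simp <;> ring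
  rw [pow_add, ← Matrix.mul_smul, h, Matrix.mul_sub, Matrix.mul_smul, ← pow_succ, mul_one]

lemma tendsto_inv_sq_pow_mulVec {A B : ℤ} (hA : 4 ≤ A) (h3 : B = 2 * A - 3)
    {x : ℕ → Fin 2 → ℝ} {D : ℝ} (hx : ∀ n, ‖x n‖ ≤ D) :
    Tendsto (fun n => (((M' A B)⁻¹ ^ 2) ^ n) *ᵥ x n) atTop (𝓝 0) := by
  obtain ⟨C, hC⟩ := exists_norm_inv_sq_pow_le hA h3
  refine squeeze_zero_norm (a := fun n => C * (1 / 2) ^ n * D) (fun n => ?_) ?_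
  · refine (Matrix.linfty_opNorm_mulVec _ _).trans ?_
    exact mul_le_mul (hC n) (hx n) (norm_nonneg _) ((norm_nonneg _).trans (hC n))
  · have := ((tendsto_pow_atTop_nhds_zero_of_lt_one (r := (1 / 2 : ℝ)) (by norm_num)
      (by norm_num)).const_mul C).mul_const D
    simpa using this

lemma summable_inv_sq_pow_mulVec {A B : ℤ} (hA : 4 ≤ A) (h3 : B = 2 * A - 3) (v : Fin 2 → ℝ) :
    Summable fun n => (((M' A B)⁻¹ ^ 2) ^ n) *ᵥ v := by
  obtain ⟨C, hC⟩ := exists_norm_inv_sq_pow_le hA h3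
  refine Summable.of_norm_bounded (g := fun n => C * (1 / 2) ^ n * ‖v‖) ?_ fun n => ?_
  · exact ((summable_geometric_of_lt_one (by norm_num) (by norm_num)).mul_left C).mul_right _
  · refine (Matrix.linfty_opNorm_mulVec _ _).trans ?_
    exact mul_le_mul_of_nonneg_right (hC n) (norm_nonneg _)

/-- The point with digit expansion `0.\overline{0(B-1)}`. -/
def periodicPt (A B : ℤ) : Fin 2 → ℝ :=
  ∑' k : ℕ, (((M' A B)⁻¹ ^ 2) ^ k) *ᵥ (((M' A B)⁻¹ ^ 2) *ᵥ (((B : ℝ) - 1) • e1))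

lemma ptTail_eq {A B : ℤ} (hA : 4 ≤ A) (h3 : B = 2 * A - 3) (a₁ a₂ a₃ : ℤ) :
    ptTail A B a₁ a₂ a₃ =
      ((M' A B)⁻¹ ^ 1) *ᵥ ((a₁ : ℝ) • e1) + ((M' A B)⁻¹ ^ 2) *ᵥ ((a₂ : ℝ) • e1)
        + ((M' A B)⁻¹ ^ 3) *ᵥ ((a₃ : ℝ) • e1) + ((M' A B)⁻¹ ^ 3) *ᵥ periodicPt A B := by
  have h := (summable_inv_sq_pow_mulVec hA h3 (((M' A B)⁻¹ ^ 2) *ᵥ e1)).hasSum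
  have h' := h.map (Matrix.mulVecLin ((M' A B)⁻¹ ^ 3))
    (LinearMap.continuous_of_finiteDimensional _)
  have hfun : (⇑(Matrix.mulVecLin ((M' A B)⁻¹ ^ 3)) ∘
      fun n => (((M' A B)⁻¹ ^ 2) ^ n) *ᵥ (((M' A B)⁻¹ ^ 2) *ᵥ e1)) =
      fun k => ((M' A B)⁻¹ ^ (5 + 2 * k)) *ᵥ e1 := by
    funext k
    simp only [Function.comp, Matrix.mulVecLin_apply, Matrix.mulVec_mulVec, ← pow_mul, ← pow_add]
    congr 2
    ring
  rw [hfun] at h'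
  have hp := (h.const_smul ((B : ℝ) - 1)).tsum_eq
  rw [ptTail, h'.tsum_eq, periodicPt]
  simp only [Matrix.mulVec_smul] at hp ⊢
  rw [hp, Matrix.mulVec_smul]
  rfl

/-- The iterates of `v ↦ M⁻²(v + (B-1)e₁)` converge to `periodicPt A B`, uniformly on bounded
sets. -/
lemma tendsto_iterate {A B : ℤ} (hA : 4 ≤ A) (h3 : B = 2 * A - 3)
    {x : ℕ → Fin 2 → ℝ} {D : ℝ} (hx : ∀ n, ‖x n‖ ≤ D) :
    Tendsto (fun n => (fun v => ((M' A B)⁻¹ ^ 2) *ᵥ (v + ((B : ℝ) - 1) • e1))^[n] (x n))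
      atTop (𝓝 (periodicPt A B)) := by
  have hit : ∀ n v, (fun v => ((M' A B)⁻¹ ^ 2) *ᵥ (v + ((B : ℝ) - 1) • e1))^[n] v =
      (∑ k ∈ Finset.range n,
        (((M' A B)⁻¹ ^ 2) ^ k) *ᵥ (((M' A B)⁻¹ ^ 2) *ᵥ (((B : ℝ) - 1) • e1)))
        + (((M' A B)⁻¹ ^ 2) ^ n) *ᵥ v := by
    intro n
    induction n with
    | zero => simp
    | succ n ih =>
      intro v
      rw [Function.iterate_succ_apply, ih, Finset.sum_range_succ, Matrix.mulVec_add,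
        Matrix.mulVec_add, Matrix.mulVec_mulVec v, ← pow_succ]
      abel
  have h := (summable_inv_sq_pow_mulVec hA h3
    (((M' A B)⁻¹ ^ 2) *ᵥ (((B : ℝ) - 1) • e1))).hasSum.tendsto_sum_nat.add
    (tendsto_inv_sq_pow_mulVec hA h3 hx)
  rw [add_zero] at h
  simp only [hit]
  exact h

lemma prefix_diff {A B : ℤ} (hB : 2 ≤ B) (d : ℝ) :
    ((M' A B)⁻¹ ^ 1) *ᵥ e1 + ((M' A B)⁻¹ ^ 2) *ᵥ (((A : ℝ) - 2) • e1)
      + ((M' A B)⁻¹ ^ 3) *ᵥ (d • e1) = ((M' A B)⁻¹ ^ 3) *ᵥ ![-(B : ℝ) + d, -2] := by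
  have hB' : (B : ℝ) ≠ 0 := by exact_mod_cast (by omega : B ≠ 0)
  rw [inv_M' hB]
  ext i
  fin_cases i <;> simp [pow_succ, Matrix.mulVec, dotProduct, Matrix.mul_apply, Fin.sum_univ_two, e1]
    <;> field_simp <;> ring

lemma mem_subPiece_three {A B : ℤ} {T : Set (Fin 2 → ℝ)} {a₁ a₂ a₃ : ℤ} {z : Fin 2 → ℝ} :
    z ∈ subPiece A B T ![a₁, a₂, a₃] ↔ ∃ x ∈ T,
      ((M' A B)⁻¹ ^ 1) *ᵥ ((a₁ : ℝ) • e1) + ((M' A B)⁻¹ ^ 2) *ᵥ ((a₂ : ℝ) • e1)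
        + ((M' A B)⁻¹ ^ 3) *ᵥ ((a₃ : ℝ) • e1) + ((M' A B)⁻¹ ^ 3) *ᵥ x = z := by
  simp [subPiece, Fin.sum_univ_three]

/-- Two addresses whose digits differ by `1`, `A - 2`, `d` give the same point exactly when the
tails differ by the corresponding lattice vector. -/
lemma prefix_add_eq_iff {A B : ℤ} (hB : 2 ≤ B) {a₁ a₂ a₃ a₁' a₂' a₃' : ℤ}
    (hd1 : a₁ - a₁' = 1) (hd2 : a₂ - a₂' = A - 2) (x x' : Fin 2 → ℝ) :
    ((M' A B)⁻¹ ^ 1) *ᵥ ((a₁ : ℝ) • e1) + ((M' A B)⁻¹ ^ 2) *ᵥ ((a₂ : ℝ) • e1)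
        + ((M' A B)⁻¹ ^ 3) *ᵥ ((a₃ : ℝ) • e1) + ((M' A B)⁻¹ ^ 3) *ᵥ x =
      ((M' A B)⁻¹ ^ 1) *ᵥ ((a₁' : ℝ) • e1) + ((M' A B)⁻¹ ^ 2) *ᵥ ((a₂' : ℝ) • e1)
        + ((M' A B)⁻¹ ^ 3) *ᵥ ((a₃' : ℝ) • e1) + ((M' A B)⁻¹ ^ 3) *ᵥ x' ↔
      x' - x = ![-(B : ℝ) + ((a₃ : ℝ) - a₃'), -2] := by
  have e1' : (a₁ : ℝ) = a₁' + 1 := by exact_mod_cast (by omega : a₁ = a₁' + 1)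
  have e2' : (a₂ : ℝ) = a₂' + (A - 2) := by exact_mod_cast (by omega : a₂ = a₂' + (A - 2))
  have hp := prefix_diff (A := A) hB ((a₃ : ℝ) - a₃')
  rw [← (inv_pow_mulVec_injective (A := A) hB 3).eq_iff (a := x' - x)]
  simp only [← hp, e1', e2', add_smul, sub_smul, one_smul, Matrix.mulVec_add, Matrix.mulVec_sub]
  constructor <;> intro h
  · linear_combination -h
  · linear_combination -h

lemma inv_mulVec_add_mem {A B : ℤ} (hB : 2 ≤ B) {T : Set (Fin 2 → ℝ)}
    (hT : (M' A B).mulVec '' T =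
      ⋃ j ∈ Set.Icc (0 : ℤ) (B - 1), (fun x => x + (j : ℝ) • e1) '' T)
    {t : Fin 2 → ℝ} (ht : t ∈ T) {j : ℤ} (hj : j ∈ Set.Icc (0 : ℤ) (B - 1)) :
    (M' A B)⁻¹ *ᵥ (t + (j : ℝ) • e1) ∈ T := by
  have h : t + (j : ℝ) • e1 ∈ (M' A B).mulVec '' T := by
    rw [hT]
    exact Set.mem_biUnion hj ⟨t, ht, rfl⟩
  obtain ⟨x, hx, hxt⟩ := h
  rwa [← hxt, inv_mulVec_mulVec hB]

/-- Every point of the tile has a digit expansion. -/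
lemma exists_digits {A B : ℤ} {T : Set (Fin 2 → ℝ)}
    (hT : (M' A B).mulVec '' T =
      ⋃ j ∈ Set.Icc (0 : ℤ) (B - 1), (fun x => x + (j : ℝ) • e1) '' T)
    {x : Fin 2 → ℝ} (hx : x ∈ T) :
    ∃ (X : ℕ → Fin 2 → ℝ) (d : ℕ → ℤ), X 0 = x ∧ (∀ n, X n ∈ T) ∧
      (∀ n, d n ∈ Set.Icc (0 : ℤ) (B - 1)) ∧
      ∀ n, M' A B *ᵥ X n = X (n + 1) + (d n : ℝ) • e1 := by
  have h : ∀ x : T, ∃ (t : T) (j : ℤ), j ∈ Set.Icc (0 : ℤ) (B - 1) ∧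
      M' A B *ᵥ x.1 = t.1 + (j : ℝ) • e1 := by
    rintro ⟨x, hx⟩
    have h : M' A B *ᵥ x ∈ (M' A B).mulVec '' T := ⟨x, hx, rfl⟩
    rw [hT] at h
    simp only [Set.mem_iUnion] at h
    obtain ⟨j, hj, t, ht, htx⟩ := h
    exact ⟨⟨t, ht⟩, j, hj, htx.symm⟩
  choose f j hj hf using h
  refine ⟨fun n => (f^[n] ⟨x, hx⟩).1, fun n => j (f^[n] ⟨x, hx⟩), rfl, fun n => Subtype.coe_prop _,
    fun n => hj _, fun n => ?_⟩
  simp only [Function.iterate_succ_apply']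
  exact hf _

lemma inv_sq_mulVec (A B : ℤ) (v : Fin 2 → ℝ) :
    ((M' A B)⁻¹ ^ 2) *ᵥ v = (M' A B)⁻¹ *ᵥ ((M' A B)⁻¹ *ᵥ v) := by
  rw [Matrix.mulVec_mulVec, pow_two]

lemma periodicPt_mem {A B : ℤ} (hA : 4 ≤ A) (h3 : B = 2 * A - 3) {T : Set (Fin 2 → ℝ)}
    (hTne : T.Nonempty) (hTcp : IsCompact T)
    (hT : (M' A B).mulVec '' T =
      ⋃ j ∈ Set.Icc (0 : ℤ) (B - 1), (fun x => x + (j : ℝ) • e1) '' T) :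
    periodicPt A B ∈ T := by
  have hB : 2 ≤ B := by omega
  obtain ⟨t, ht⟩ := hTne
  refine hTcp.isClosed.mem_of_tendsto
    (tendsto_iterate hA h3 (x := fun _ => t) (D := ‖t‖) fun _ => le_rfl)
    (Eventually.of_forall fun n => ?_)
  refine Set.MapsTo.iterate (fun v hv => ?_) n ht
  have h := inv_mulVec_add_mem hB hT
    (inv_mulVec_add_mem hB hT hv (j := B - 1) ⟨by omega, le_rfl⟩) (j := 0) ⟨le_rfl, by omega⟩
  rw [inv_sq_mulVec]
  simpa only [Int.cast_sub, Int.cast_one, Int.cast_zero, zero_smul, add_zero] using h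

lemma periodicPt_eq {A B : ℤ} (hA : 4 ≤ A) (h3 : B = 2 * A - 3) :
    (M' A B)⁻¹ *ᵥ ((M' A B)⁻¹ *ᵥ (periodicPt A B + ((B : ℝ) - 1) • e1)) = periodicPt A B := by
  have h : Function.IsFixedPt
      (fun v => ((M' A B)⁻¹ ^ 2) *ᵥ (v + ((B : ℝ) - 1) • e1)) (periodicPt A B) := by
    refine isFixedPt_of_tendsto_iterate
      (tendsto_iterate hA h3 (x := fun _ => 0) (D := 0) fun _ => norm_zero.le) ?_
    exact (Continuous.matrix_mulVec continuous_const
      (continuous_id.add continuous_const)).continuousAt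
  rw [← inv_sq_mulVec]
  exact h

lemma mulVec_eq (A B : ℤ) (v : Fin 2 → ℝ) :
    M' A B *ᵥ v = ![-(B : ℝ) * v 1, v 0 - A * v 1] := by
  ext i
  fin_cases i <;> simp [M', Matrix.mulVec, dotProduct, Fin.sum_univ_two]
  ring

/-- The points `0.\overline{0(B-1)}` and `0.\overline{(B-1)0}` differ by a lattice vector. -/
lemma shift_sub_periodicPt {A B : ℤ} (hA : 4 ≤ A) (h3 : B = 2 * A - 3) :
    (M' A B)⁻¹ *ᵥ (periodicPt A B + ((B : ℝ) - 1) • e1) - periodicPt A B =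
      ![-(B : ℝ) - 1, -2] := by
  have hB : 2 ≤ B := by omega
  have hA' : (4 : ℝ) ≤ A := by exact_mod_cast hA
  have hB' : (B : ℝ) = 2 * A - 3 := by exact_mod_cast h3
  have hp := periodicPt_eq hA h3
  set p := periodicPt A B
  set w := (M' A B)⁻¹ *ᵥ (p + ((B : ℝ) - 1) • e1) with hw
  have h1 : M' A B *ᵥ p = w := by rw [← hp, mulVec_inv_mulVec hB]
  have h2 : M' A B *ᵥ w = p + ((B : ℝ) - 1) • e1 := by rw [hw, mulVec_inv_mulVec hB]
  rw [mulVec_eq] at h1 h2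
  have h10 : -(B : ℝ) * p 1 = w 0 := congrFun h1 0
  have h11 : p 0 - A * p 1 = w 1 := congrFun h1 1
  have h20 : -(B : ℝ) * w 1 = p 0 + ((B : ℝ) - 1) := by simpa [e1] using congrFun h2 0
  have h21 : w 0 - A * w 1 = p 1 := by simpa [e1] using congrFun h2 1
  rw [hB'] at *
  have hs : w 1 - p 1 = -2 := by
    have h : ((A : ℝ) - 2) * (w 1 - p 1) = (A - 2) * (-2) := by
      linear_combination h10 - h11 - h20 + h21
    exact mul_left_cancel₀ (by linarith) h
  ext i
  fin_cases i
  · change w 0 - p 0 = -(2 * (A : ℝ) - 3) - 1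
    linear_combination h21 - h11 + ((A : ℝ) - 1) * hs
  · exact hs

/-- The only lattice vector of the form `(-B + δ, -2)` which is a difference of two points of the
tile has `δ = -1`, and it is attained only at the periodic point. -/
lemma eq_periodicPt_of_sub_eq {A B : ℤ} (hA : 4 ≤ A) (h3 : B = 2 * A - 3) {T : Set (Fin 2 → ℝ)}
    (hTcp : IsCompact T)
    (hT : (M' A B).mulVec '' T =
      ⋃ j ∈ Set.Icc (0 : ℤ) (B - 1), (fun x => x + (j : ℝ) • e1) '' T)
    {x x' : Fin 2 → ℝ} (hx : x ∈ T) (hx' : x' ∈ T) {δ : ℤ}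
    (hδ : x' - x = ![-(B : ℝ) + δ, -2]) : δ = -1 ∧ x = periodicPt A B := by
  have hB : 2 ≤ B := by omega
  obtain ⟨X, d, hX0, hXT, hd, hX⟩ := exists_digits hT hx
  obtain ⟨X', d', hX0', hXT', hd', hX'⟩ := exists_digits hT hx'
  obtain ⟨D, hD⟩ := hTcp.isBounded.exists_norm_le
  have hstep : ∀ n, X' (n + 1) - X (n + 1) =
      M' A B *ᵥ (X' n - X n) - ((d' n : ℝ) - d n) • e1 := by
    intro n
    rw [Matrix.mulVec_sub, hX, hX', sub_smul]
    abel
  have hint : ∀ n, ∃ u v : ℤ, X' n - X n = ![(u : ℝ), (v : ℝ)] := by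
    intro n
    induction n with
    | zero => exact ⟨-B + δ, -2, by rw [hX0, hX0', hδ]; push_cast; rfl⟩
    | succ n ih =>
      obtain ⟨u, v, huv⟩ := ih
      refine ⟨-B * v - (d' n - d n), u - A * v, ?_⟩
      rw [hstep, huv, mulVec_eq]
      ext i
      fin_cases i <;> simp [e1]
  choose u y huy using hint
  have hu : ∀ n, u (n + 1) = -B * y n - (d' n - d n) ∧ y (n + 1) = u n - A * y n := by
    intro n
    have h := hstep n
    rw [huy, huy, mulVec_eq] at h
    have h0 := congrFun h 0
    have h1 := congrFun h 1
    simp [e1] at h0 h1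
    constructor
    · have : (u (n + 1) : ℝ) = -B * y n - (d' n - d n) := by linarith
      exact_mod_cast this
    · exact_mod_cast h1
  have hrec : ∀ n, y (n + 2) + A * y (n + 1) + (2 * A - 3) * y n = d n - d' n := by
    intro n
    rw [(hu (n + 1)).2, (hu n).1, h3]
    ring
  have hbd : ∀ n, |y (n + 2) + A * y (n + 1) + (2 * A - 3) * y n| ≤ 2 * A - 4 := by
    intro n
    obtain ⟨h1, h2⟩ := hd n
    obtain ⟨h1', h2'⟩ := hd' n
    rw [hrec, abs_le]
    constructor <;> linarith
  have hC : ∀ n, |y n| ≤ ⌈D + D⌉ := by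
    intro n
    have h1 : ‖(X' n - X n) 1‖ ≤ D + D :=
      (norm_le_pi_norm _ 1).trans
        ((norm_sub_le _ _).trans (add_le_add (hD _ (hXT' n)) (hD _ (hXT n))))
    rw [huy, Real.norm_eq_abs] at h1
    have h2 : |(y n : ℝ)| ≤ D + D := h1
    exact_mod_cast h2.trans (Int.le_ceil _)
  have h00 : u 0 = -B + δ ∧ y 0 = -2 := by
    have h := huy 0
    rw [hX0, hX0', hδ] at h
    have h0 : -(B : ℝ) + δ = u 0 := congrFun h 0
    have h1 : (-2 : ℝ) = y 0 := congrFun h 1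
    exact ⟨by exact_mod_cast h0.symm, by exact_mod_cast h1.symm⟩
  have halt := eq_two_mul_neg_one_pow hA hC hbd h00.2
  refine ⟨?_, ?_⟩
  · have h1 : y 1 = 2 := (halt 0).2
    have h2 := (hu 0).2
    rw [h00.1, h00.2, zero_add, h1] at h2
    linarith
  · have hback : ∀ n, X (2 * n) =
        (fun v => ((M' A B)⁻¹ ^ 2) *ᵥ (v + ((B : ℝ) - 1) • e1)) (X (2 * (n + 1))) := by
      intro n
      have h0 := hrec (2 * n)
      have h1 := hrec (2 * n + 1)
      have ha := halt n
      have hb : y (2 * n + 2) = -2 ∧ y (2 * n + 3) = 2 := halt (n + 1)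
      rw [hb.1, ha.1, ha.2] at h0
      rw [show 2 * n + 1 + 2 = 2 * n + 3 from rfl, show 2 * n + 1 + 1 = 2 * n + 2 from rfl,
        hb.1, hb.2, ha.2] at h1
      have hd0 : d (2 * n) = 0 := by linarith [(hd (2 * n)).1, (hd' (2 * n)).2]
      have hd1 : d (2 * n + 1) = B - 1 := by linarith [(hd (2 * n + 1)).2, (hd' (2 * n + 1)).1]
      have hM0 := hX (2 * n)
      have hM1 := hX (2 * n + 1)
      rw [hd0, Int.cast_zero, zero_smul, add_zero] at hM0
      rw [hd1, Int.cast_sub, Int.cast_one] at hM1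
      beta_reduce
      rw [inv_sq_mulVec, show 2 * (n + 1) = 2 * n + 1 + 1 from rfl, ← hM1, inv_mulVec_mulVec hB,
        ← hM0, inv_mulVec_mulVec hB]
    have hiter : ∀ n,
        (fun v => ((M' A B)⁻¹ ^ 2) *ᵥ (v + ((B : ℝ) - 1) • e1))^[n] (X (2 * n)) = x := by
      intro n
      induction n with
      | zero => exact hX0
      | succ n ih => exact ih ▸ congrArg _ (hback n).symm
    have h := tendsto_iterate hA h3 (x := fun n => X (2 * n)) fun n => hD _ (hXT _)
    simp only [hiter] at h
    exact tendsto_nhds_unique tendsto_const_nhds h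

end TileTail

/-- For `0 < A ≤ B`, `B ≥ 2`, `2A - B = 3`, `A ≠ B`, and digits
with `a₁ - a₁' = 1` and `a₂ - a₂' = A - 2`, the pieces `T_{a₁a₂a₃}` and
`T_{a₁'a₂'a₃'}` intersect iff `a₃ - a₃' = -1`, and in that case the intersection
is the singleton `{0.a₁a₂a₃\overline{0(B-1)}}`. -/
theorem subPiece_three_inter_Aminus2
    (A B : ℤ) (hA : 0 < A) (hAB : A ≤ B) (hB : 2 ≤ B)
    (h3 : 2 * A - B = 3) (hABne : A ≠ B)
    (T : Set (Fin 2 → ℝ)) (hTne : T.Nonempty) (hTcp : IsCompact T)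
    (hT : (M' A B).mulVec '' T =
      ⋃ j ∈ Set.Icc (0 : ℤ) (B - 1), (fun x => x + (j : ℝ) • e1) '' T)
    (a₁ a₂ a₃ a₁' a₂' a₃' : ℤ)
    (ha₁ : a₁ ∈ Set.Icc (0 : ℤ) (B - 1)) (ha₂ : a₂ ∈ Set.Icc (0 : ℤ) (B - 1))
    (ha₃ : a₃ ∈ Set.Icc (0 : ℤ) (B - 1))
    (ha₁' : a₁' ∈ Set.Icc (0 : ℤ) (B - 1)) (ha₂' : a₂' ∈ Set.Icc (0 : ℤ) (B - 1))
    (ha₃' : a₃' ∈ Set.Icc (0 : ℤ) (B - 1))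
    (hd1 : a₁ - a₁' = 1) (hd2 : a₂ - a₂' = A - 2) :
    ((subPiece A B T ![a₁, a₂, a₃] ∩ subPiece A B T ![a₁', a₂', a₃']).Nonempty ↔
      a₃ - a₃' = -1) ∧
    (a₃ - a₃' = -1 →
      subPiece A B T ![a₁, a₂, a₃] ∩ subPiece A B T ![a₁', a₂', a₃'] =
        {ptTail A B a₁ a₂ a₃}) := by
  have hA4 : 4 ≤ A := by omega
  have hB' : B = 2 * A - 3 := by omega
  have hinter : a₃ - a₃' = -1 →
      subPiece A B T ![a₁, a₂, a₃] ∩ subPiece A B T ![a₁', a₂', a₃'] =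
        {ptTail A B a₁ a₂ a₃} := by
    intro hd3
    have hd3' : -(B : ℝ) + ((a₃ : ℝ) - a₃') = -(B : ℝ) - 1 := by
      have : (a₃ : ℝ) - a₃' = -1 := by exact_mod_cast hd3
      rw [this, sub_eq_add_neg]
    have hp := TileTail.periodicPt_mem hA4 hB' hTne hTcp hT
    refine Set.eq_singleton_iff_unique_mem.2 ⟨⟨?_, ?_⟩, ?_⟩
    · exact TileTail.mem_subPiece_three.2 ⟨_, hp, (TileTail.ptTail_eq hA4 hB' _ _ _).symm⟩
    · have hw := TileTail.inv_mulVec_add_mem hB hT hp (j := B - 1) ⟨by omega, le_rfl⟩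
      refine TileTail.mem_subPiece_three.2 ⟨_, hw, ?_⟩
      rw [TileTail.ptTail_eq hA4 hB', eq_comm, TileTail.prefix_add_eq_iff hB hd1 hd2, hd3',
        Int.cast_sub, Int.cast_one, TileTail.shift_sub_periodicPt hA4 hB']
    · rintro z ⟨hz, hz'⟩
      obtain ⟨x, hx, rfl⟩ := TileTail.mem_subPiece_three.1 hz
      obtain ⟨x', hx', h⟩ := TileTail.mem_subPiece_three.1 hz'
      have hxx := (TileTail.prefix_add_eq_iff hB hd1 hd2 x x').1 h.symm
      rw [← Int.cast_sub] at hxx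
      rw [TileTail.ptTail_eq hA4 hB',
        (TileTail.eq_periodicPt_of_sub_eq hA4 hB' hTcp hT hx hx' hxx).2]
  refine ⟨⟨?_, fun h => ?_⟩, hinter⟩
  · rintro ⟨z, hz, hz'⟩
    obtain ⟨x, hx, rfl⟩ := TileTail.mem_subPiece_three.1 hz
    obtain ⟨x', hx', h⟩ := TileTail.mem_subPiece_three.1 hz'
    have hxx := (TileTail.prefix_add_eq_iff hB hd1 hd2 x x').1 h.symm
    rw [← Int.cast_sub] at hxx
    exact (TileTail.eq_periodicPt_of_sub_eq hA4 hB' hTcp hT hx hx' hxx).1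
  · rw [hinter h]
    exact Set.singleton_nonempty _
end
end

section
/- Let A, B ∈ ℤ with 0 < A ≤ B and B ≥ 2, let M₁ = [[0, −B], [1, −A]] and M₂ = [[0, −B], [1, A]] acting on ℝ², let P = [[1, 0], [0, −1]], and let T₁, T₂ be the unique nonempty compact subsets of ℝ² satisfying M₁·T₁ = ⋃_{j=0}^{B−1} (T₁ + j·e₁) and M₂·T₂ = ⋃_{j=0}^{B−1} (T₂ + j·e₁) respectively. Then P·M₁·P⁻¹ = −M₂ and T₂ = P·T₁ + v, where v = Σ_{i≥0} M₂^{−(2i+1)}·((B−1)·e₁). In particular T₁ and T₂ are affinely equivalent via a reflection followed by a translation. -/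
noncomputable section

open Filter Topology Matrix

section Powers

/-- If some positive power of `x` is a strict contraction, then the geometric series of `x`
is absolutely convergent. -/
theorem summable_norm_pow_of_norm_pow_lt_one {R : Type*} [NormedRing R] {x : R} {m : ℕ}
    [NeZero m] (h : ‖x ^ m‖ < 1) : Summable fun n : ℕ => ‖x ^ n‖ := by
  rw [← (Nat.divModEquiv m).symm.summable_iff]
  have hprod : Summable fun p : ℕ × Fin m => ‖(x ^ m) ^ p.1‖ * ‖x ^ (p.2 : ℕ)‖ :=
    (summable_norm_geometric_of_norm_lt_one h).mul_of_nonneg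
      (Summable.of_finite (f := fun s : Fin m => ‖x ^ (s : ℕ)‖))
      (fun _ => norm_nonneg _) (fun _ => norm_nonneg _)
  refine Summable.of_nonneg_of_le (fun _ => norm_nonneg _) (fun p => ?_) hprod
  have hp : x ^ ((Nat.divModEquiv m).symm p) = (x ^ m) ^ p.1 * x ^ (p.2 : ℕ) := by
    rw [← pow_mul, ← pow_add, Nat.divModEquiv_symm_apply]
    congr 1
    ring
  simp only [Function.comp_apply, hp]
  exact norm_mul_le _ _

attribute [local instance] Matrix.linftyOpNormedRing Matrix.linftyOpNormedAlgebra

theorem linftyOpNorm_companion_pow_four_lt_one {a b : ℝ} (ha : 0 < a) (ha1 : a ≤ 1)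
    (hb : 0 < b) (hb2 : b ≤ 1 / 2) : ‖!![a, -b; 1, 0] ^ 4‖ < 1 := by
  have hpow : !![a, -b; 1, 0] ^ 4 =
      !![a ^ 4 - 3 * a ^ 2 * b + b ^ 2, -(b * (a * (a ^ 2 - 2 * b)));
        a * (a ^ 2 - 2 * b), -(b * (a ^ 2 - b))] := by
    ext i j
    fin_cases i <;> fin_cases j <;> simp [pow_succ, Matrix.mul_apply] <;> ring
  have ha2 : a ^ 2 ≤ 1 := by nlinarith
  have hab : a * b ≤ 1 / 2 := by nlinarith
  have hab0 : 0 < a * b := by positivity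
  have ha2b : a ^ 2 * b ≤ a * b := by nlinarith
  have hbb : b ^ 2 ≤ 1 / 4 := by nlinarith
  have hbb0 : 0 < b ^ 2 := by positivity
  have ha20 : 0 < a ^ 2 := by positivity
  have habb : a * b ^ 2 ≤ b ^ 2 := by nlinarith
  have habb0 : 0 < a * b ^ 2 := by positivity
  have ha3 : a ^ 3 ≤ a ^ 2 := by nlinarith
  have ha30 : 0 < a ^ 3 := by positivity
  have ha3b : a ^ 3 * b ≤ a ^ 2 * b := by nlinarith
  have ha3b0 : 0 < a ^ 3 * b := by positivity
  have hrow₀ : |a ^ 4 - 3 * a ^ 2 * b + b ^ 2| + |b * (a * (a ^ 2 - 2 * b))| < 1 := by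
    rcases le_total (2 * b) (a ^ 2) with h | h
    · rw [abs_of_nonneg (mul_nonneg hb.le (mul_nonneg ha.le (sub_nonneg.2 h)))]
      rcases abs_cases (a ^ 4 - 3 * a ^ 2 * b + b ^ 2) with ⟨h', -⟩ | ⟨h', -⟩ <;> rw [h']
      · nlinarith
      · nlinarith [sq_nonneg (a ^ 2 - 3 / 2 * b)]
    · rw [abs_of_nonpos (mul_nonpos_of_nonneg_of_nonpos hb.le
        (mul_nonpos_of_nonneg_of_nonpos ha.le (sub_nonpos.2 h)))]
      rcases abs_cases (a ^ 4 - 3 * a ^ 2 * b + b ^ 2) with ⟨h', -⟩ | ⟨h', -⟩ <;> rw [h']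
      · nlinarith [mul_le_mul_of_nonneg_left h ha20.le]
      · nlinarith [sq_nonneg (a ^ 2 - 3 / 2 * b)]
  have hrow₁ : |a * (a ^ 2 - 2 * b)| + |b * (a ^ 2 - b)| < 1 := by
    rcases abs_cases (a * (a ^ 2 - 2 * b)) with ⟨h, -⟩ | ⟨h, -⟩ <;>
    rcases abs_cases (b * (a ^ 2 - b)) with ⟨h', -⟩ | ⟨h', -⟩ <;> rw [h, h'] <;> nlinarith
  rw [hpow, Matrix.linfty_opNorm_def, ← NNReal.coe_one, NNReal.coe_lt_coe,
    Finset.sup_lt_iff (by simp)]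
  intro i _
  rw [← NNReal.coe_lt_coe]
  fin_cases i
  · simpa using hrow₀
  · simpa using hrow₁

theorem summable_companion_pow {a b : ℝ} (ha : 0 < a) (ha1 : a ≤ 1)
    (hb : 0 < b) (hb2 : b ≤ 1 / 2) : Summable fun n : ℕ => !![a, -b; 1, 0] ^ n :=
  have := FiniteDimensional.complete ℝ (Matrix (Fin 2) (Fin 2) ℝ)
  (summable_norm_pow_of_norm_pow_lt_one
    (linftyOpNorm_companion_pow_four_lt_one ha ha1 hb hb2)).of_norm

end Powers

/-- A bounded set that is contained in its image under a contractive iterated function system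
with common linear part lies in every nonempty closed set invariant under the system. -/
theorem subset_of_affine_invariant {ι : Type*} [Fintype ι] [DecidableEq ι] {L : Matrix ι ι ℝ}
    (hL : Tendsto (fun n : ℕ => L ^ n) atTop (𝓝 0)) {E X Y : Set (ι → ℝ)}
    (hXb : Bornology.IsBounded X) (hYc : IsClosed Y) (hYne : Y.Nonempty)
    (hX : ∀ x ∈ X, ∃ x' ∈ X, ∃ e ∈ E, x = L *ᵥ x' + e)
    (hY : ∀ y ∈ Y, ∀ e ∈ E, L *ᵥ y + e ∈ Y) : X ⊆ Y := by
  intro x hx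
  have hiter : ∀ n : ℕ, ∀ x ∈ X, ∃ x' ∈ X, ∀ y ∈ Y, x + L ^ n *ᵥ (y - x') ∈ Y := by
    intro n
    induction n with
    | zero => exact fun x hx => ⟨x, hx, fun y hy => by simpa using hy⟩
    | succ n ih =>
      intro x hx
      obtain ⟨x₁, hx₁, e, he, rfl⟩ := hX x hx
      obtain ⟨x', hx', h⟩ := ih x₁ hx₁
      refine ⟨x', hx', fun y hy => ?_⟩
      have := hY _ (h y hy) e he
      rw [Matrix.mulVec_add, Matrix.mulVec_mulVec, ← pow_succ'] at this
      convert this using 1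
      abel
  obtain ⟨y, hy⟩ := hYne
  choose u hu huY using fun n => hiter n x hx
  refine hYc.mem_of_tendsto (f := fun n : ℕ => x + L ^ n *ᵥ (y - u n)) (b := atTop) ?_
    (Eventually.of_forall fun n => huY n y hy)
  obtain ⟨R, hR⟩ := hXb.exists_norm_le
  have hzero : Tendsto (fun n : ℕ => L ^ n *ᵥ (y - u n)) atTop (𝓝 0) := by
    rw [tendsto_pi_nhds]
    intro i
    simp only [Matrix.mulVec, dotProduct, Pi.zero_apply]
    rw [← Finset.sum_const_zero (s := (Finset.univ : Finset ι))]
    refine tendsto_finsetSum _ fun j _ => ?_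
    have hLij : Tendsto (fun n : ℕ => (L ^ n) i j) atTop (𝓝 0) := by
      have := tendsto_pi_nhds.1 (tendsto_pi_nhds.1 hL i) j
      simpa using this
    refine hLij.zero_mul_isBoundedUnder_le ?_
    refine ⟨‖y‖ + R, eventually_map.2 (Eventually.of_forall fun n => ?_)⟩
    calc ‖(y - u n) j‖ ≤ ‖y - u n‖ := norm_le_pi_norm _ j
      _ ≤ ‖y‖ + ‖u n‖ := norm_sub_le _ _
      _ ≤ ‖y‖ + R := by gcongr; exact hR _ (hu n)
  simpa using hzero.const_add x

/-- The digit form of the set equation `M·T = ⋃ⱼ (T + j·e)` for an invertible matrix `M`. -/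
theorem mem_iff_of_mulVec_image_eq {ι : Type*} [Fintype ι] [DecidableEq ι] {M : Matrix ι ι ℝ}
    (hM : IsUnit M.det) {T : Set (ι → ℝ)} {D : Set ℤ} {e : ι → ℝ}
    (hT : M.mulVec '' T = ⋃ j ∈ D, (fun x => x + (j : ℝ) • e) '' T) (x : ι → ℝ) :
    x ∈ T ↔ ∃ j ∈ D, ∃ x' ∈ T, x = M⁻¹ *ᵥ (x' + (j : ℝ) • e) := by
  have hx : x ∈ T ↔ M *ᵥ x ∈ M.mulVec '' T :=
    ((Matrix.mulVec_injective_iff_isUnit.2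
      ((Matrix.isUnit_iff_isUnit_det M).2 hM)).mem_set_image).symm
  rw [hx, hT]
  simp only [Set.mem_iUnion, Set.mem_image, exists_prop]
  refine exists_congr fun j => and_congr_right fun _ => exists_congr fun x' =>
    and_congr_right fun _ => ⟨fun h => ?_, fun h => ?_⟩
  · rw [h, Matrix.mulVec_mulVec, Matrix.nonsing_inv_mul _ hM, Matrix.one_mulVec]
  · rw [h, Matrix.mulVec_mulVec, Matrix.mul_nonsing_inv _ hM, Matrix.one_mulVec]

theorem summable_inv_pow {A B : ℝ} (hA : 0 < A) (hAB : A ≤ B) (hB : 2 ≤ B) :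
    Summable fun n : ℕ => (!![0, -B; 1, A])⁻¹ ^ n := by
  have hB0 : 0 < B := by linarith
  have hinv : (!![0, -B; 1, A])⁻¹ = (!![A / B, -(1 / B); 1, 0])ᵀ := by
    apply Matrix.inv_eq_right_inv
    ext i j
    fin_cases i <;> fin_cases j <;> simp [Matrix.mul_apply, hB0.ne']
    field_simp
    ring
  have hsum := (summable_companion_pow (div_pos hA hB0) ((div_le_one hB0).2 hAB)
    (one_div_pos.2 hB0) (one_div_le_one_div_of_le two_pos hB)).matrix_transpose
  simpa only [hinv, Matrix.transpose_pow] using hsum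



/-- With `M₁ = [[0,-B],[1,-A]]`, `M₂ = [[0,-B],[1,A]]`,
`P = [[1,0],[0,-1]]` and tiles `T₁, T₂`, we have `P·M₁·P⁻¹ = -M₂` and
`T₂ = P·T₁ + v` with `v = Σ_{i≥0} M₂^{-(2i+1)}·((B-1)e₁)`. -/
theorem tile_reflection
    (A B : ℤ) (hA : 0 < A) (hAB : A ≤ B) (hB : 2 ≤ B)
    (T₁ T₂ : Set (Fin 2 → ℝ))
    (hT₁ne : T₁.Nonempty) (hT₁cp : IsCompact T₁)
    (hT₂ne : T₂.Nonempty) (hT₂cp : IsCompact T₂)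
    (hT₁ : (!![0, -(B : ℝ); 1, -(A : ℝ)]).mulVec '' T₁ =
      ⋃ j ∈ Set.Icc (0 : ℤ) (B - 1), (fun x => x + (j : ℝ) • ![1, 0]) '' T₁)
    (hT₂ : (!![0, -(B : ℝ); 1, (A : ℝ)]).mulVec '' T₂ =
      ⋃ j ∈ Set.Icc (0 : ℤ) (B - 1), (fun x => x + (j : ℝ) • ![1, 0]) '' T₂) :
    (!![1, 0; 0, -1] : Matrix (Fin 2) (Fin 2) ℤ) * !![0, -B; 1, -A] *
        (!![1, 0; 0, -1] : Matrix (Fin 2) (Fin 2) ℤ)⁻¹ = -(!![0, -B; 1, A]) ∧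
    T₂ = (fun x => (!![(1 : ℝ), 0; 0, -1]).mulVec x +
      ∑' i : ℕ, ((!![0, -(B : ℝ); 1, (A : ℝ)])⁻¹ ^ (2 * i + 1)).mulVec
        (((B : ℝ) - 1) • ![1, 0])) '' T₁ := by
  refine ⟨?_, ?_⟩
  · have hP : (!![1, 0; 0, -1] : Matrix (Fin 2) (Fin 2) ℤ)⁻¹ = !![1, 0; 0, -1] := by
      apply Matrix.inv_eq_right_inv
      ext i j
      fin_cases i <;> fin_cases j <;> simp [Matrix.mul_apply]
    rw [hP]
    ext i j
    fin_cases i <;> fin_cases j <;> simp [Matrix.mul_apply]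
  have hB2 : (2 : ℝ) ≤ B := by exact_mod_cast hB
  have hB0 : (B : ℝ) ≠ 0 := by linarith
  have hsum := summable_inv_pow (A := A) (B := B) (by exact_mod_cast hA)
    (by exact_mod_cast hAB) hB2
  have hdet₁ : IsUnit (!![0, -(B : ℝ); 1, -(A : ℝ)]).det := by simp [Matrix.det_fin_two, hB0]
  have hdet₂ : IsUnit (!![0, -(B : ℝ); 1, (A : ℝ)]).det := by simp [Matrix.det_fin_two, hB0]
  have hmem₁ := mem_iff_of_mulVec_image_eq hdet₁ hT₁
  have hmem₂ := mem_iff_of_mulVec_image_eq hdet₂ hT₂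
  have hconj : !![(1 : ℝ), 0; 0, -1] * (!![0, -(B : ℝ); 1, -(A : ℝ)])⁻¹ =
      -((!![0, -(B : ℝ); 1, (A : ℝ)])⁻¹ * !![(1 : ℝ), 0; 0, -1]) := by
    rw [Matrix.inv_def, Matrix.inv_def, Matrix.adjugate_fin_two, Matrix.adjugate_fin_two]
    ext i j
    fin_cases i <;> fin_cases j <;> simp [Matrix.mul_apply, Matrix.det_fin_two]
  have hPe : !![(1 : ℝ), 0; 0, -1] *ᵥ ![1, 0] = ![1, 0] := by
    ext i
    fin_cases i <;> simp
  generalize (!![0, -(B : ℝ); 1, -(A : ℝ)])⁻¹ = K₁ at *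
  generalize (!![0, -(B : ℝ); 1, (A : ℝ)])⁻¹ = K at *
  generalize !![(1 : ℝ), 0; 0, -1] = P at *
  generalize (![1, 0] : Fin 2 → ℝ) = e at *
  have hsumv : Summable fun i : ℕ => (K ^ (2 * i + 1)) *ᵥ (((B : ℝ) - 1) • e) := by
    have hodd : Summable fun i : ℕ => K ^ (2 * i + 1) :=
      hsum.comp_injective (i := fun i => 2 * i + 1) fun _ _ h => by simpa using h
    exact hodd.map (Matrix.mulVec.addMonoidHomLeft (((B : ℝ) - 1) • e))
      (continuous_id.matrix_mulVec continuous_const)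
  have hv : ∑' i : ℕ, (K ^ (2 * i + 1)) *ᵥ (((B : ℝ) - 1) • e) =
      ((B : ℝ) - 1) • K *ᵥ e +
        K ^ 2 *ᵥ ∑' i : ℕ, (K ^ (2 * i + 1)) *ᵥ (((B : ℝ) - 1) • e) := by
    have hmap := hsumv.hasSum.map (Matrix.mulVecLin (K ^ 2))
      (continuous_const.matrix_mulVec continuous_id)
    have heq : (fun i : ℕ => (K ^ (2 * (i + 1) + 1)) *ᵥ (((B : ℝ) - 1) • e)) =
        Matrix.mulVecLin (K ^ 2) ∘ fun i : ℕ => (K ^ (2 * i + 1)) *ᵥ (((B : ℝ) - 1) • e) := by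
      funext i
      simp only [Function.comp_apply, Matrix.mulVecLin_apply, Matrix.mulVec_mulVec, ← pow_add]
      congr 2
      ring
    rw [← heq] at hmap
    refine hsumv.tsum_eq_zero_add.trans ?_
    rw [hmap.tsum_eq, Matrix.mulVecLin_apply, mul_zero, zero_add, pow_one, Matrix.mulVec_smul]
  generalize ∑' i : ℕ, (K ^ (2 * i + 1)) *ᵥ (((B : ℝ) - 1) • e) = v at *
  have hK2 : ∀ x, K *ᵥ (K *ᵥ x) = K ^ 2 *ᵥ x := fun x => by
    rw [Matrix.mulVec_mulVec, sq]
  have hlim : Tendsto (fun n : ℕ => (K ^ 2) ^ n) atTop (𝓝 0) := by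
    simp only [← pow_mul]
    exact hsum.tendsto_atTop_zero.comp (tendsto_id.const_mul_atTop' two_pos)
  have hPstep : ∀ (x : Fin 2 → ℝ) (j : ℝ), P *ᵥ (K₁ *ᵥ (x + j • e)) =
      -(K *ᵥ (P *ᵥ x)) - j • K *ᵥ e := fun x j => by
    rw [Matrix.mulVec_mulVec, hconj, Matrix.neg_mulVec, ← Matrix.mulVec_mulVec,
      Matrix.mulVec_add P, Matrix.mulVec_smul, hPe, Matrix.mulVec_add, Matrix.mulVec_smul]
    abel
  set E : Set (Fin 2 → ℝ) := {d | ∃ i ∈ Set.Icc (0 : ℤ) (B - 1), ∃ j ∈ Set.Icc (0 : ℤ) (B - 1),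
    d = (i : ℝ) • K *ᵥ e + (j : ℝ) • K ^ 2 *ᵥ e} with hE
  have hstep₂ : ∀ (x : Fin 2 → ℝ) (i j : ℝ), K *ᵥ (K *ᵥ (x + j • e) + i • e) =
      K ^ 2 *ᵥ x + (i • K *ᵥ e + j • K ^ 2 *ᵥ e) := fun x i j => by
    simp only [Matrix.mulVec_add, Matrix.mulVec_smul, hK2]
    abel
  have hstep₁ : ∀ (x : Fin 2 → ℝ) (i j : ℝ),
      P *ᵥ (K₁ *ᵥ (K₁ *ᵥ (x + j • e) + i • e)) + v =
      K ^ 2 *ᵥ (P *ᵥ x + v) + (((B : ℝ) - 1 - i) • K *ᵥ e + j • K ^ 2 *ᵥ e) := fun x i j => by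
    rw [hPstep, hPstep]
    nth_rewrite 1 [hv]
    simp only [Matrix.mulVec_add, Matrix.mulVec_sub, Matrix.mulVec_neg, Matrix.mulVec_smul, hK2,
      sub_smul]
    abel
  have hcont : Continuous fun x : Fin 2 → ℝ => P *ᵥ x + v :=
    (continuous_const.matrix_mulVec continuous_id).add continuous_const
  have hcp := hT₁cp.image hcont
  apply Set.Subset.antisymm
  · refine subset_of_affine_invariant (E := E) hlim hT₂cp.isBounded hcp.isClosed
      (hT₁ne.image _) ?_ ?_
    · intro x hx
      obtain ⟨i, hi, y, hy, rfl⟩ := (hmem₂ x).1 hx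
      obtain ⟨j, hj, z, hz, rfl⟩ := (hmem₂ y).1 hy
      exact ⟨z, hz, _, ⟨i, hi, j, hj, rfl⟩, hstep₂ z i j⟩
    · rintro _ ⟨x, hx, rfl⟩ _ ⟨i, hi, j, hj, rfl⟩
      refine ⟨_, (hmem₁ _).2 ⟨B - 1 - i, ?_, _, (hmem₁ _).2 ⟨j, hj, x, hx, rfl⟩, rfl⟩, ?_⟩
      · simp only [Set.mem_Icc] at hi ⊢
        omega
      · dsimp only
        rw [hstep₁]
        push_cast
        rw [sub_sub_cancel]
  · refine subset_of_affine_invariant (E := E) hlim hcp.isBounded hT₂cp.isClosed hT₂ne ?_ ?_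
    · rintro _ ⟨x, hx, rfl⟩
      obtain ⟨i, hi, y, hy, rfl⟩ := (hmem₁ x).1 hx
      obtain ⟨j, hj, z, hz, rfl⟩ := (hmem₁ y).1 hy
      refine ⟨_, ⟨z, hz, rfl⟩, _, ⟨B - 1 - i, ?_, j, hj, rfl⟩, ?_⟩
      · simp only [Set.mem_Icc] at hi ⊢
        omega
      · dsimp only
        rw [hstep₁]
        push_cast
        rfl
    · rintro x hx _ ⟨i, hi, j, hj, rfl⟩
      rw [← hstep₂]
      exact (hmem₂ _).2 ⟨i, hi, _, (hmem₂ _).2 ⟨j, hj, x, hx, rfl⟩, rfl⟩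
end
end

section
/- Let A, B ∈ ℤ with 1 ≤ A ≤ B and B ≥ 2, let M = [[0, −B], [1, −A]] acting on ℝ², and let T be the tile for M and digits {0, …, B−1}·e₁. Let R = {(1,0), (−1,0), (A−1,1), (−A+1,−1), (A,1), (−A,−1)} ⊂ ℤ². Then there exists a unique family (K_s)_{s∈R} of nonempty compact subsets of ℝ² such that for every s ∈ R, K_s = ⋃ M⁻¹·(K_{s'} + a·e₁), where the union is over all s' ∈ R and a ∈ {0, …, B−1} for which there exists a' ∈ {0, …, B−1} with M·s + a'·e₁ = s' + a·e₁; moreover, the topological boundary of T satisfies ∂T = ⋃_{s∈R} K_s. -/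
noncomputable section

/-- The set `R = {(1,0), (-1,0), (A-1,1), (-A+1,-1), (A,1), (-A,-1)} ⊂ ℤ²`. -/
def nbrSet (A : ℤ) : Set (Fin 2 → ℤ) :=
  {![1, 0], ![-1, 0], ![A - 1, 1], ![-A + 1, -1], ![A, 1], ![-A, -1]}

/-- The boundary GIFS property: each `K_s` is nonempty, compact, and
`K_s = ⋃ M⁻¹(K_{s'} + a·e₁)` over all edges `s → s'` with output digit `a`. -/
def bdryGIFS (A B : ℤ) (K : ↥(nbrSet A) → Set (Fin 2 → ℝ)) : Prop :=
  ∀ s : ↥(nbrSet A), (K s).Nonempty ∧ IsCompact (K s) ∧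
    K s = ⋃ s' : ↥(nbrSet A), ⋃ a ∈ Set.Icc (0 : ℤ) (B - 1),
      ⋃ (_ : ∃ a' ∈ Set.Icc (0 : ℤ) (B - 1),
        (!![0, -B; 1, -A] : Matrix (Fin 2) (Fin 2) ℤ).mulVec (s : Fin 2 → ℤ)
          + a' • (![1, 0] : Fin 2 → ℤ) = (s' : Fin 2 → ℤ) + a • ![1, 0]),
      (fun x => (M' A B)⁻¹.mulVec (x + (a : ℝ) • e1)) '' K s'


namespace CNSTile

open Set

/-- The inclusion of `ℤ²` into `ℝ²`. -/
def toPlane : (Fin 2 → ℤ) →+ (Fin 2 → ℝ) := (Int.castAddHom ℝ).compLeft (Fin 2)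

@[simp] lemma toPlane_apply (z : Fin 2 → ℤ) (i : Fin 2) : toPlane z i = (z i : ℝ) := rfl

/-- The action of `M` on `ℤ²`. -/
def mulZ (A B : ℤ) (z : Fin 2 → ℤ) : Fin 2 → ℤ := ![-B * z 1, z 0 - A * z 1]

/-- The action of `M` on `ℝ²`. -/
def mulR (A B : ℤ) : (Fin 2 → ℝ) →ₗ[ℝ] (Fin 2 → ℝ) := (M' A B).mulVecLin

/-- The quotient map `z ↦ M⁻¹ (z - d)`, where `d` is the unique digit congruent to `z`. -/
def quot (A B : ℤ) (z : Fin 2 → ℤ) : Fin 2 → ℤ := ![z 1 - A * (z 0 / B), -(z 0 / B)]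

/-- The edge relation of the boundary graph, on all of `ℤ²`. -/
def Edge (A B : ℤ) (s s' : Fin 2 → ℤ) (a : ℤ) : Prop :=
  a ∈ Icc (0 : ℤ) (B - 1) ∧ ∃ a' ∈ Icc (0 : ℤ) (B - 1),
    mulZ A B s + a' • (![1, 0] : Fin 2 → ℤ) = s' + a • ![1, 0]

/-- The graph-directed Hutchinson operator. -/
def hutch (A B : ℤ) (K : ↥(nbrSet A) → Set (Fin 2 → ℝ)) (s : ↥(nbrSet A)) :
    Set (Fin 2 → ℝ) :=
  {x | ∃ (s' : ↥(nbrSet A)) (a : ℤ), Edge A B s s' a ∧ mulR A B x - (a : ℝ) • e1 ∈ K s'}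

variable {A B : ℤ}

instance : Finite ↥(nbrSet A) := by unfold nbrSet; infer_instance

lemma mulR_apply (v : Fin 2 → ℝ) : mulR A B v = ![-(B : ℝ) * v 1, v 0 - A * v 1] := by
  ext i
  fin_cases i <;> simp [mulR, M', Matrix.mulVec, dotProduct, Fin.sum_univ_two]
  ring

lemma mulR_toPlane (z : Fin 2 → ℤ) : mulR A B (toPlane z) = toPlane (mulZ A B z) := by
  ext i
  fin_cases i <;> simp [mulR_apply, mulZ]

lemma toPlane_e1 (j : ℤ) : toPlane (j • ![1, 0]) = (j : ℝ) • e1 := by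
  ext i
  fin_cases i <;> simp [e1]

lemma mulVec_eq_mulZ (z : Fin 2 → ℤ) :
    (!![0, -B; 1, -A] : Matrix (Fin 2) (Fin 2) ℤ).mulVec z = mulZ A B z := by
  ext i
  fin_cases i <;> simp [mulZ, Matrix.mulVec, dotProduct, Fin.sum_univ_two]
  ring

lemma mulZ_sub (z w : Fin 2 → ℤ) : mulZ A B (z - w) = mulZ A B z - mulZ A B w := by
  ext i
  fin_cases i <;> simp [mulZ] <;> ring

lemma mulZ_quot (z : Fin 2 → ℤ) :
    mulZ A B (quot A B z) + (z 0 % B) • (![1, 0] : Fin 2 → ℤ) = z := by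
  ext i
  fin_cases i
  · simpa [mulZ, quot] using Int.mul_ediv_add_emod (z 0) B
  · simp [mulZ, quot]

lemma quot_mulZ_add (z : Fin 2 → ℤ) {j : ℤ} (hj : j ∈ Icc 0 (B - 1)) :
    quot A B (mulZ A B z + j • (![1, 0] : Fin 2 → ℤ)) = z := by
  have hB : B ≠ 0 := by have := hj.1.trans hj.2; omega
  have h : (-(B * z 1) + j) / B = -z 1 := by
    rw [show -(B * z 1) + j = j + B * (-z 1) by ring, Int.add_mul_ediv_left _ _ hB,
      Int.ediv_eq_zero_of_lt hj.1 (by have := hj.2; omega), zero_add]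
  ext i
  fin_cases i <;> simp [mulZ, quot, h]

lemma det_mulR : LinearMap.det (mulR A B) = B := by
  simp [mulR, M', Matrix.det_fin_two, ← Matrix.toLin'_apply']

lemma det_M' : (M' A B).det = B := by simp [M', Matrix.det_fin_two]

lemma mulR_inv (hB : 2 ≤ B) (v : Fin 2 → ℝ) : mulR A B ((M' A B)⁻¹.mulVec v) = v := by
  have : IsUnit (M' A B).det := by
    rw [det_M']; exact IsUnit.mk0 _ (by exact_mod_cast (by omega : B ≠ 0))
  rw [mulR, Matrix.mulVecLin_apply, Matrix.mulVec_mulVec, Matrix.mul_nonsing_inv _ this,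
    Matrix.one_mulVec]

lemma inv_mulR (hB : 2 ≤ B) (v : Fin 2 → ℝ) : (M' A B)⁻¹.mulVec (mulR A B v) = v := by
  have : IsUnit (M' A B).det := by
    rw [det_M']; exact IsUnit.mk0 _ (by exact_mod_cast (by omega : B ≠ 0))
  rw [mulR, Matrix.mulVecLin_apply, Matrix.mulVec_mulVec, Matrix.nonsing_inv_mul _ this,
    Matrix.one_mulVec]

lemma mulR_injective (hB : 2 ≤ B) : Function.Injective (mulR A B) :=
  Function.LeftInverse.injective (inv_mulR hB)

lemma mulR_surjective (hB : 2 ≤ B) : Function.Surjective (mulR A B) :=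
  Function.RightInverse.surjective (mulR_inv hB)

lemma bdryGIFS_iff (hB : 2 ≤ B) (K : ↥(nbrSet A) → Set (Fin 2 → ℝ)) :
    bdryGIFS A B K ↔ ∀ s, (K s).Nonempty ∧ IsCompact (K s) ∧ K s = hutch A B K s := by
  refine forall_congr' fun s => and_congr_right fun _ => and_congr_right fun _ => ?_
  suffices h : (⋃ s' : ↥(nbrSet A), ⋃ a ∈ Set.Icc (0 : ℤ) (B - 1),
      ⋃ (_ : ∃ a' ∈ Set.Icc (0 : ℤ) (B - 1),
        (!![0, -B; 1, -A] : Matrix (Fin 2) (Fin 2) ℤ).mulVec (s : Fin 2 → ℤ)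
          + a' • (![1, 0] : Fin 2 → ℤ) = (s' : Fin 2 → ℤ) + a • ![1, 0]),
      (fun x => (M' A B)⁻¹.mulVec (x + (a : ℝ) • e1)) '' K s') = hutch A B K s by
    rw [h]
  ext x
  simp only [mem_iUnion, hutch, Edge, mulVec_eq_mulZ, mem_ofPred_eq, mem_image, exists_prop]
  refine exists_congr fun s' => exists_congr fun a => ?_
  rw [and_assoc]
  refine and_congr_right fun _ => and_congr_right fun _ => ?_
  constructor
  · rintro ⟨y, hy, rfl⟩
    rwa [mulR_inv hB, add_sub_cancel_right]
  · intro h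
    exact ⟨_, h, by rw [sub_add_cancel, inv_mulR hB]⟩

lemma neg_mem_nbrSet {s : Fin 2 → ℤ} (hs : s ∈ nbrSet A) : -s ∈ nbrSet A := by
  simp only [nbrSet, mem_insert_iff, mem_singleton_iff] at hs ⊢
  rcases hs with rfl | rfl | rfl | rfl | rfl | rfl <;> simp [neg_add_eq_sub]

lemma exists_edge (hA : 1 ≤ A) (hAB : A ≤ B) {s : Fin 2 → ℤ} (hs : s ∈ nbrSet A) :
    ∃ s' ∈ nbrSet A, ∃ a, Edge A B s s' a := by
  have key : ∀ s' ∈ nbrSet A, ∀ a a' : ℤ, a ∈ Icc 0 (B - 1) → a' ∈ Icc 0 (B - 1) →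
      mulZ A B s + a' • (![1, 0] : Fin 2 → ℤ) = s' + a • ![1, 0] →
      ∃ s' ∈ nbrSet A, ∃ a, Edge A B s s' a := fun s' h a a' ha ha' he =>
    ⟨s', h, a, ha, a', ha', he⟩
  simp only [nbrSet, mem_insert_iff, mem_singleton_iff] at hs
  rcases hs with rfl | rfl | rfl | rfl | rfl | rfl
  · refine key ![A - 1, 1] (by simp [nbrSet]) 0 (A - 1) ?_ ?_ ?_ <;> simp [mulZ] <;> omega
  · refine key ![-A + 1, -1] (by simp [nbrSet]) (A - 1) 0 ?_ ?_ ?_ <;> simp [mulZ] <;> omega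
  · refine key ![-A, -1] (by simp [nbrSet]) 0 (B - A) ?_ ?_ ?_ <;> simp [mulZ] <;> omega
  · refine key ![A, 1] (by simp [nbrSet]) (B - A) 0 ?_ ?_ ?_ <;> simp [mulZ] <;> omega
  · refine key ![-1, 0] (by simp [nbrSet]) 0 (B - 1) ?_ ?_ ?_ <;> simp [mulZ] <;> omega
  · refine key ![1, 0] (by simp [nbrSet]) (B - 1) 0 ?_ ?_ ?_ <;> simp [mulZ] <;> omega

lemma mem_nbrSet_of_edge (hA : 1 ≤ A) (hAB : A ≤ B) {s r : Fin 2 → ℤ} {a : ℤ}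
    (hr : r ∈ nbrSet A) (h : Edge A B s r a) (hs : s ≠ 0) : s ∈ nbrSet A := by
  obtain ⟨⟨ha, ha1⟩, a', ⟨ha', ha1'⟩, h⟩ := h
  have h0 := congrFun h 0
  have h1 := congrFun h 1
  obtain ⟨x, y, rfl⟩ : ∃ x y, s = ![x, y] := ⟨s 0, s 1, by ext i; fin_cases i <;> rfl⟩
  simp [mulZ] at h0 h1
  have hr0 : -A ≤ r 0 ∧ r 0 ≤ A := by
    simp only [nbrSet, mem_insert_iff, mem_singleton_iff] at hr
    rcases hr with rfl | rfl | rfl | rfl | rfl | rfl <;> simp <;> omega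
  have hy1 : y < 2 := by by_contra!; nlinarith
  have hy2 : -2 < y := by by_contra!; nlinarith
  have hxy : ¬ (x = 0 ∧ y = 0) := by
    rintro ⟨rfl, rfl⟩; exact hs (by ext i; fin_cases i <;> rfl)
  have hiff : ∀ u v : ℤ, (![x, y] : Fin 2 → ℤ) = ![u, v] ↔ x = u ∧ y = v := by
    intro u v
    simp
  simp only [nbrSet, mem_insert_iff, mem_singleton_iff, hiff] at hr ⊢
  rcases hr with rfl | rfl | rfl | rfl | rfl | rfl <;> simp at h0 h1 <;>
    interval_cases y <;> omega

/-- A seminorm comparable to the sup norm in which `M` expands by the factor `1 / c`. -/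
structure IsAdapted (A B : ℤ) (q : Seminorm ℝ (Fin 2 → ℝ)) (c C : ℝ) : Prop where
  c_nonneg : 0 ≤ c
  c_lt_one : c < 1
  C_pos : 0 < C
  le_mulR : ∀ v, q v ≤ c * q (mulR A B v)
  norm_le : ∀ v, ‖v‖ ≤ C * q v
  le_norm : ∀ v, q v ≤ C * ‖v‖

/-- An explicit adapted seminorm, obtained from the quadratic form
`(v - τ u)² + (1 - τ²) / 2 * u²` with `τ = A / (B + 1)`. -/
lemma exists_isAdapted (hA : 1 ≤ A) (hAB : A ≤ B) (hB : 2 ≤ B) :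
    ∃ q c C, IsAdapted A B q c C := by
  have hA' : (1 : ℝ) ≤ A := by exact_mod_cast hA
  have hAB' : (A : ℝ) ≤ B := by exact_mod_cast hAB
  have hB' : (2 : ℝ) ≤ B := by exact_mod_cast hB
  set τ : ℝ := A / (B + 1) with hτ
  have hτA : (A : ℝ) = τ * (B + 1) := by rw [hτ]; field_simp
  have hτ0 : 0 ≤ τ := by positivity
  have hτ1 : τ < 1 := by rw [hτ, div_lt_one (by linarith)]; linarith
  set κ : ℝ := (1 - τ ^ 2) / 4 with hκ
  have hκ0 : 0 < κ := by rw [hκ]; nlinarith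
  set ρ : ℝ := Real.sqrt ((1 - τ ^ 2) / 2) with hρ
  have hρ2 : ρ ^ 2 = 2 * κ := by rw [hρ, Real.sq_sqrt (by linarith)]; rw [hκ]; ring
  have hρ0 : 0 < ρ := Real.sqrt_pos.mpr (by linarith)
  let L : (Fin 2 → ℝ) →ₗ[ℝ] ℂ :=
    { toFun := fun v => ⟨v 1 - τ * v 0, ρ * v 0⟩
      map_add' := fun v w => by apply Complex.ext <;> simp <;> ring
      map_smul' := fun t v => by apply Complex.ext <;> simp <;> ring }
  have hq : ∀ v, ((normSeminorm ℝ ℂ).comp L v) ^ 2 = (v 1 - τ * v 0) ^ 2 + 2 * κ * v 0 ^ 2 := by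
    intro v
    have : (normSeminorm ℝ ℂ).comp L v = ‖L v‖ := rfl
    rw [this, ← Complex.normSq_eq_norm_sq, Complex.normSq_apply]
    change (v 1 - τ * v 0) * (v 1 - τ * v 0) + (ρ * v 0) * (ρ * v 0) = _
    rw [← hρ2]; ring
  have hle : ∀ x y : ℝ, 0 ≤ y → x ^ 2 ≤ y ^ 2 → x ≤ y := fun x y hy h => abs_le_of_sq_le_sq' h hy |>.2
  have hn : ∀ v : Fin 2 → ℝ, v 0 ^ 2 ≤ ‖v‖ ^ 2 ∧ v 1 ^ 2 ≤ ‖v‖ ^ 2 := fun v => by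
    constructor <;> rw [← sq_abs, ← Real.norm_eq_abs] <;> gcongr <;> exact norm_le_pi_norm v _
  have hκ1 : κ ≤ 1 / 4 := by rw [hκ]; nlinarith
  refine ⟨(normSeminorm ℝ ℂ).comp L, Real.sqrt (1 / (1 + κ)), 2 + 1 / κ, ?_, ?_, ?_, ?_, ?_, ?_⟩
  · positivity
  · rw [Real.sqrt_lt' one_pos, one_pow, div_lt_one (by linarith)]; linarith
  · positivity
  · intro v
    refine hle _ _ (by positivity) ?_
    rw [mul_pow, Real.sq_sqrt (by positivity), hq, hq, one_div, inv_mul_eq_div,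
      le_div_iff₀ (by linarith)]
    simp only [mulR_apply, Matrix.cons_val_zero, Matrix.cons_val_one]
    have h1 : (v 1 - τ * v 0) ^ 2 + 2 * κ * v 0 ^ 2 ≤ 2 * (v 0 ^ 2 + v 1 ^ 2) := by
      nlinarith [sq_nonneg (v 1 + τ * v 0), sq_nonneg (v 0), sq_nonneg (v 1)]
    have h2 : (v 0 - A * v 1 - τ * (-B * v 1)) ^ 2 + 2 * κ * (-B * v 1) ^ 2
        - ((v 1 - τ * v 0) ^ 2 + 2 * κ * v 0 ^ 2)
        = 2 * κ * (v 0 ^ 2 + (B ^ 2 - 2) * v 1 ^ 2) := by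
      rw [hτA, hκ]; ring
    have h3 : 2 * κ * (v 0 ^ 2 + v 1 ^ 2) ≤ 2 * κ * (v 0 ^ 2 + (B ^ 2 - 2) * v 1 ^ 2) := by
      gcongr
      exact le_mul_of_one_le_left (sq_nonneg _) (by nlinarith)
    nlinarith
  · intro v
    have hq0 : 0 ≤ (normSeminorm ℝ ℂ).comp L v := apply_nonneg _ _
    have hv := hq v
    set r := (normSeminorm ℝ ℂ).comp L v
    have hC : (4 : ℝ) + 4 / κ ≤ (2 + 1 / κ) ^ 2 := by
      have : (2 + 1 / κ) ^ 2 = 4 + 4 / κ + (1 / κ) ^ 2 := by field_simp; ring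
      rw [this]; nlinarith [sq_nonneg (1 / κ)]
    have h0 : v 0 ^ 2 ≤ r ^ 2 / κ := by
      rw [le_div_iff₀ hκ0]; nlinarith [sq_nonneg (v 1 - τ * v 0), sq_nonneg (v 0)]
    have h1 : v 1 ^ 2 ≤ 2 * r ^ 2 + 2 * v 0 ^ 2 := by
      nlinarith [sq_nonneg (v 1 - 2 * τ * v 0), sq_nonneg (v 0),
        mul_nonneg hκ0.le (sq_nonneg (v 0))]
    have h2 : r ^ 2 * (4 + 4 / κ) ≤ r ^ 2 * (2 + 1 / κ) ^ 2 := by gcongr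
    have h3 : r ^ 2 * (4 + 4 / κ) = 4 * r ^ 2 + 4 * (r ^ 2 / κ) := by ring
    have h4 : 0 ≤ r ^ 2 / κ := by positivity
    rw [pi_norm_le_iff_of_nonneg (by positivity)]
    intro i
    rw [Real.norm_eq_abs]
    refine hle _ _ (by positivity) ?_
    rw [sq_abs]
    fin_cases i <;> simp only [Fin.zero_eta, Fin.mk_one] <;> nlinarith
  · intro v
    refine hle _ _ (by positivity) ?_
    rw [hq, mul_pow]
    have hC : (4 : ℝ) ≤ (2 + 1 / κ) ^ 2 := by
      have : 0 < 1 / κ := by positivity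
      nlinarith
    have h2 : 4 * ‖v‖ ^ 2 ≤ (2 + 1 / κ) ^ 2 * ‖v‖ ^ 2 := by gcongr
    nlinarith [sq_nonneg (v 1 + τ * v 0), hn v, sq_nonneg (v 0), sq_nonneg (v 1)]

namespace IsAdapted

variable {q : Seminorm ℝ (Fin 2 → ℝ)} {c C : ℝ}

lemma le_iterate (h : IsAdapted A B q c C) (n : ℕ) (v : Fin 2 → ℝ) :
    q v ≤ c ^ n * q ((mulR A B)^[n] v) := by
  induction n generalizing v with
  | zero => simp
  | succ n ih =>
    calc q v ≤ c * q (mulR A B v) := h.le_mulR v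
      _ ≤ c * (c ^ n * q ((mulR A B)^[n] (mulR A B v))) :=
        mul_le_mul_of_nonneg_left (ih _) h.c_nonneg
      _ = _ := by rw [Function.iterate_succ_apply]; ring

lemma sub_le_iterate (h : IsAdapted A B q c C) (n : ℕ) (v w : Fin 2 → ℝ) :
    q (v - w) ≤ c ^ n * q ((mulR A B)^[n] v - (mulR A B)^[n] w) := by
  simpa only [iterate_map_sub] using h.le_iterate n (v - w)

lemma exists_pow_lt (h : IsAdapted A B q c C) (D : ℝ) {ε : ℝ} (hε : 0 < ε) :
    ∃ n : ℕ, C * (c ^ n * D) < ε := by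
  have : Filter.Tendsto (fun n : ℕ => C * (c ^ n * D)) Filter.atTop (nhds (C * (0 * D))) :=
    ((tendsto_pow_atTop_nhds_zero_of_lt_one h.c_nonneg h.c_lt_one).mul_const D).const_mul C
  rw [zero_mul, mul_zero] at this
  exact (this.eventually (gt_mem_nhds hε)).exists

lemma mem_of_isClosed (h : IsAdapted A B q c C) {S : Set (Fin 2 → ℝ)} (hS : IsClosed S)
    {x : Fin 2 → ℝ} (D : ℝ) (hx : ∀ n : ℕ, ∃ y ∈ S, q (x - y) ≤ c ^ n * D) : x ∈ S := by
  rw [← hS.closure_eq, Metric.mem_closure_iff]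
  intro ε hε
  obtain ⟨n, hn⟩ := h.exists_pow_lt D hε
  obtain ⟨y, hy, hxy⟩ := hx n
  refine ⟨y, hy, ?_⟩
  rw [dist_eq_norm]
  exact ((h.norm_le _).trans (mul_le_mul_of_nonneg_left hxy h.C_pos.le)).trans_lt hn

lemma exists_bound (h : IsAdapted A B q c C) {S : Set (Fin 2 → ℝ)} (hS : Bornology.IsBounded S) :
    ∃ D, 0 ≤ D ∧ ∀ x ∈ S, q x ≤ D := by
  obtain ⟨R, hR⟩ := hS.exists_norm_le
  refine ⟨C * max R 0, by have := h.C_pos; positivity, fun x hx => ?_⟩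
  exact (h.le_norm x).trans
    (mul_le_mul_of_nonneg_left ((hR x hx).trans (le_max_left _ _)) h.C_pos.le)

lemma continuous (h : IsAdapted A B q c C) : Continuous q := by
  refine Seminorm.continuous_of_continuousAt_zero ?_
  rw [ContinuousAt, map_zero]
  have : Filter.Tendsto (fun v : Fin 2 → ℝ => C * ‖v‖) (nhds 0) (nhds (C * ‖(0 : Fin 2 → ℝ)‖)) :=
    (continuous_const.mul continuous_norm).tendsto 0
  rw [norm_zero, mul_zero] at this
  exact squeeze_zero (fun v => apply_nonneg q v) h.le_norm this

lemma isBounded_of_le (h : IsAdapted A B q c C) {S : Set (Fin 2 → ℝ)} {D : ℝ}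
    (hS : ∀ x ∈ S, q x ≤ D) : Bornology.IsBounded S :=
  isBounded_iff_forall_norm_le.mpr ⟨C * D, fun x hx =>
    (h.norm_le x).trans (mul_le_mul_of_nonneg_left (hS x hx) h.C_pos.le)⟩

/-- A bounded sub-solution of the GIFS equations is contained in every closed super-solution. -/
lemma subset_of_hutch (h : IsAdapted A B q c C) (hB : 2 ≤ B)
    {X Y : ↥(nbrSet A) → Set (Fin 2 → ℝ)}
    (hX : ∀ s, X s ⊆ hutch A B X s) (hY : ∀ s, hutch A B Y s ⊆ Y s)
    (hXb : ∀ s, Bornology.IsBounded (X s)) (hYb : ∀ s, (Y s).Nonempty)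
    (hYc : ∀ s, IsClosed (Y s)) (s : ↥(nbrSet A)) : X s ⊆ Y s := by
  choose y₀ hy₀ using hYb
  have hbd : Bornology.IsBounded ((⋃ s, X s) ∪ range y₀) :=
    (Bornology.isBounded_iUnion.mpr hXb).union (finite_range y₀).isBounded
  obtain ⟨D, hD0, hD⟩ := h.exists_bound hbd
  have key : ∀ (n : ℕ) (s) (x), x ∈ X s → ∃ y ∈ Y s, q (x - y) ≤ c ^ n * (D + D) := by
    intro n
    induction n with
    | zero =>
      intro s x hx
      refine ⟨y₀ s, hy₀ s, ?_⟩
      rw [pow_zero, one_mul]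
      exact (map_sub_le_add q _ _).trans (add_le_add
        (hD _ (.inl (mem_iUnion_of_mem s hx))) (hD _ (.inr (mem_range_self s))))
    | succ n ih =>
      intro s x hx
      obtain ⟨s', a, hE, hx'⟩ := hX s hx
      obtain ⟨y, hy, hxy⟩ := ih s' _ hx'
      obtain ⟨w, hw⟩ := mulR_surjective (A := A) hB (y + (a : ℝ) • e1)
      refine ⟨w, hY s ⟨s', a, hE, by rwa [hw, add_sub_cancel_right]⟩, ?_⟩
      calc q (x - w) ≤ c * q (mulR A B (x - w)) := h.le_mulR _
        _ = c * q (mulR A B x - (a : ℝ) • e1 - y) := by rw [map_sub, hw]; congr 2; abel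
        _ ≤ c * (c ^ n * (D + D)) := mul_le_mul_of_nonneg_left hxy h.c_nonneg
        _ = _ := by ring
  intro x hx
  exact h.mem_of_isClosed (hYc s) (D + D) fun n => key n s x hx

end IsAdapted

lemma hutch_mono {X Y : ↥(nbrSet A) → Set (Fin 2 → ℝ)} (h : ∀ s, X s ⊆ Y s)
    (s : ↥(nbrSet A)) : hutch A B X s ⊆ hutch A B Y s :=
  fun _ ⟨s', a, hE, hx⟩ => ⟨s', a, hE, h s' hx⟩

lemma isClosed_hutch {X : ↥(nbrSet A) → Set (Fin 2 → ℝ)} (hX : ∀ s, IsClosed (X s))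
    (s : ↥(nbrSet A)) : IsClosed (hutch A B X s) := by
  have : hutch A B X s = ⋃ s' : ↥(nbrSet A), ⋃ a ∈ {a | Edge A B s s' a},
      (fun x => mulR A B x - (a : ℝ) • e1) ⁻¹' X s' := by
    ext x; simp [hutch]
  rw [this]
  refine isClosed_iUnion_of_finite fun s' => Set.Finite.isClosed_biUnion ?_ fun a _ => ?_
  · exact (finite_Icc 0 (B - 1)).subset fun a ha => ha.1
  · exact (hX s').preimage
      ((LinearMap.continuous_of_finiteDimensional (mulR A B)).sub continuous_const)

lemma IsAdapted.exists_radius {q : Seminorm ℝ (Fin 2 → ℝ)} {c C : ℝ} (h : IsAdapted A B q c C) :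
    ∃ L, 0 ≤ L ∧ ∀ s, hutch A B (fun _ => {x | q x ≤ L}) s ⊆ {x | q x ≤ L} := by
  have hc := h.c_lt_one
  have hc0 := h.c_nonneg
  have h1 : 0 < 1 - c := by linarith
  set D := |(B : ℝ)| * q e1 with hD
  have hD0 : 0 ≤ D := by have := apply_nonneg q e1; positivity
  refine ⟨D / (1 - c), by positivity, ?_⟩
  rintro s x ⟨s', a, ⟨⟨ha0, ha1⟩, -⟩, hx⟩
  have ha : q ((a : ℝ) • e1) ≤ D := by
    rw [map_smul_eq_mul, Real.norm_eq_abs]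
    refine mul_le_mul_of_nonneg_right (abs_le_abs_of_nonneg ?_ ?_) (apply_nonneg q e1)
    · exact_mod_cast ha0
    · exact_mod_cast (by omega : a ≤ B)
  have hx' : q (mulR A B x - (a : ℝ) • e1) ≤ D / (1 - c) := hx
  have h2 : q (mulR A B x) ≤ D / (1 - c) + D := by
    calc q (mulR A B x) = q ((mulR A B x - (a : ℝ) • e1) + (a : ℝ) • e1) := by
          rw [sub_add_cancel]
      _ ≤ _ := (map_add_le_add q _ _).trans (add_le_add hx' ha)
  change q x ≤ D / (1 - c)
  calc q x ≤ c * q (mulR A B x) := h.le_mulR x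
    _ ≤ c * (D / (1 - c) + D) := mul_le_mul_of_nonneg_left h2 hc0
    _ = D / (1 - c) - D * (1 - c) := by field_simp; ring
    _ ≤ D / (1 - c) := by nlinarith

/-- A family of points `x_s` with `M x_s - a_s e₁ = x_{σ s}` exists for every choice of `σ`, `a`. -/
lemma IsAdapted.exists_points {q : Seminorm ℝ (Fin 2 → ℝ)} {c C : ℝ} (h : IsAdapted A B q c C)
    {ι : Type*} [Finite ι] (σ : ι → ι) (b : ι → Fin 2 → ℝ) :
    ∃ x : ι → Fin 2 → ℝ, ∀ s, mulR A B (x s) - b s = x (σ s) := by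
  let f : (ι → Fin 2 → ℝ) →ₗ[ℝ] (ι → Fin 2 → ℝ) :=
    { toFun := fun x s => mulR A B (x s) - x (σ s)
      map_add' := fun x y => by ext1 s; simp only [Pi.add_apply, map_add]; abel
      map_smul' := fun t x => by ext1 s; simp [smul_sub] }
  have hinj : Function.Injective f := by
    rw [← LinearMap.ker_eq_bot, LinearMap.ker_eq_bot']
    intro x hx
    have hx' : ∀ s, mulR A B (x s) = x (σ s) := fun s => sub_eq_zero.mp (congrFun hx s)
    obtain ⟨D, -, hD⟩ := h.exists_bound (finite_range x).isBounded
    have key : ∀ (n : ℕ) s, q (x s) ≤ c ^ n * D := by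
      intro n
      induction n with
      | zero => intro s; simpa using hD _ (mem_range_self s)
      | succ n ih =>
        intro s
        calc q (x s) ≤ c * q (x (σ s)) := hx' s ▸ h.le_mulR (x s)
          _ ≤ c * (c ^ n * D) := mul_le_mul_of_nonneg_left (ih _) h.c_nonneg
          _ = _ := by ring
    ext1 s
    exact h.mem_of_isClosed (isClosed_singleton (x := (0 : Fin 2 → ℝ))) D
      fun n => ⟨0, rfl, by simpa using key n s⟩
  obtain ⟨x, hx⟩ := (LinearMap.injective_iff_surjective.mp hinj) b
  refine ⟨x, fun s => ?_⟩
  have : mulR A B (x s) - x (σ s) = b s := congrFun hx s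
  rw [← this]; abel

lemma IsAdapted.exists_solution {q : Seminorm ℝ (Fin 2 → ℝ)} {c C : ℝ} (h : IsAdapted A B q c C)
    (hA : 1 ≤ A) (hAB : A ≤ B) (hB : 2 ≤ B) :
    ∃ K : ↥(nbrSet A) → Set (Fin 2 → ℝ), bdryGIFS A B K := by
  obtain ⟨L, hL0, hL⟩ := h.exists_radius
  have hball : IsClosed {x : Fin 2 → ℝ | q x ≤ L} := isClosed_le h.continuous continuous_const
  let P : (↥(nbrSet A) → Set (Fin 2 → ℝ)) → Prop := fun X =>
    (∀ s, Bornology.IsBounded (X s)) ∧ ∀ s, X s ⊆ hutch A B X s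
  have hPball : ∀ X, P X → ∀ s, X s ⊆ {x | q x ≤ L} := fun X hX =>
    h.subset_of_hutch hB hX.2 hL hX.1 (fun _ => ⟨0, by simpa using hL0⟩) fun _ => hball
  let K : ↥(nbrSet A) → Set (Fin 2 → ℝ) := fun s => {x | ∃ X, P X ∧ x ∈ X s}
  have hle : ∀ X, P X → ∀ s, X s ⊆ K s := fun X hX s x hx => ⟨X, hX, hx⟩
  have hKball : ∀ s, K s ⊆ {x | q x ≤ L} := fun s x ⟨X, hX, hx⟩ => hPball X hX s hx
  have hKb : ∀ s, Bornology.IsBounded (K s) := fun s => h.isBounded_of_le (hKball s)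
  have hKpost : ∀ s, K s ⊆ hutch A B K s := fun s x ⟨X, hX, hx⟩ =>
    hutch_mono (hle X hX) s (hX.2 s hx)
  have hKpre : ∀ s, hutch A B K s ⊆ K s := by
    refine hle _ ⟨fun s => ?_, hutch_mono hKpost⟩
    exact h.isBounded_of_le ((hutch_mono hKball s).trans (hL s))
  have hKc : ∀ s, IsClosed (K s) := by
    intro s
    refine isClosed_of_closure_subset (hle (fun s => closure (K s)) ⟨fun s => (hKb s).closure, ?_⟩ s)
    intro s
    exact closure_minimal ((hKpost s).trans (hutch_mono (fun s => subset_closure) s))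
      (isClosed_hutch (fun _ => isClosed_closure) s)
  choose σ hσ a ha using fun s : ↥(nbrSet A) => exists_edge hA hAB s.2
  obtain ⟨x, hx⟩ := h.exists_points (fun s => (⟨σ s, hσ s⟩ : ↥(nbrSet A)))
    (fun s => (a s : ℝ) • e1)
  refine ⟨K, (bdryGIFS_iff hB K).mpr fun s => ⟨⟨x s, hle (fun s => {x s}) ⟨fun s => ?_, ?_⟩ s rfl⟩,
    Metric.isCompact_of_isClosed_isBounded (hKc s) (hKb s), (hKpost s).antisymm (hKpre s)⟩⟩
  · exact Bornology.isBounded_singleton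
  · rintro s _ rfl
    exact ⟨⟨σ s, hσ s⟩, a s, ha s, hx s⟩

lemma IsAdapted.unique_solution {q : Seminorm ℝ (Fin 2 → ℝ)} {c C : ℝ} (h : IsAdapted A B q c C)
    (hB : 2 ≤ B) {K K' : ↥(nbrSet A) → Set (Fin 2 → ℝ)} (hK : bdryGIFS A B K)
    (hK' : bdryGIFS A B K') : K = K' := by
  have key : ∀ {K K' : ↥(nbrSet A) → Set (Fin 2 → ℝ)}, bdryGIFS A B K → bdryGIFS A B K' →
      ∀ s, K s ⊆ K' s := by
    intro K K' hK hK'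
    rw [bdryGIFS_iff hB] at hK hK'
    exact h.subset_of_hutch hB (fun s => (hK s).2.2.subset) (fun s => (hK' s).2.2.superset)
      (fun s => (hK s).2.1.isBounded) (fun s => (hK' s).1) fun s => (hK' s).2.1.isClosed
  ext1 s
  exact (key hK hK' s).antisymm (key hK' hK s)

/-- The set equation of the tile. -/
def IsTile (A B : ℤ) (T : Set (Fin 2 → ℝ)) : Prop :=
  mulR A B '' T = ⋃ j ∈ Icc (0 : ℤ) (B - 1), (fun x => x + (j : ℝ) • e1) '' T

namespace IsTile

variable {T : Set (Fin 2 → ℝ)}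

lemma exists_mulR_eq (hT : IsTile A B T) {t : Fin 2 → ℝ} (ht : t ∈ T) {j : ℤ}
    (hj : j ∈ Icc 0 (B - 1)) : ∃ t' ∈ T, mulR A B t' = t + toPlane (j • ![1, 0]) := by
  have : t + (j : ℝ) • e1 ∈ mulR A B '' T := by
    rw [hT]; exact mem_biUnion hj (mem_image_of_mem _ ht)
  rwa [toPlane_e1]

lemma exists_eq_mulR (hT : IsTile A B T) {t : Fin 2 → ℝ} (ht : t ∈ T) :
    ∃ j ∈ Icc (0 : ℤ) (B - 1), ∃ t' ∈ T, mulR A B t = t' + toPlane (j • ![1, 0]) := by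
  have := mem_image_of_mem (mulR A B) ht
  rw [hT] at this
  simp only [mem_iUnion] at this
  obtain ⟨j, hj, t', ht', h⟩ := this
  exact ⟨j, hj, t', ht', by rw [toPlane_e1]; exact h.symm⟩

lemma exists_iterate_eq (hT : IsTile A B T) {t : Fin 2 → ℝ} (ht : t ∈ T) (k : Fin 2 → ℤ) (n : ℕ) :
    ∃ z, (quot A B)^[n] z = k ∧ ∃ t' ∈ T,
      (mulR A B)^[n] (t + toPlane k) = t' + toPlane z := by
  induction n with
  | zero => exact ⟨k, rfl, t, ht, rfl⟩
  | succ n ih =>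
    obtain ⟨z, hz, t', ht', h⟩ := ih
    obtain ⟨j, hj, t'', ht'', h'⟩ := hT.exists_eq_mulR ht'
    refine ⟨mulZ A B z + j • ![1, 0], ?_, t'', ht'', ?_⟩
    · rw [Function.iterate_succ_apply, quot_mulZ_add z hj, hz]
    · rw [Function.iterate_succ_apply', h, map_add, h', mulR_toPlane, map_add]
      abel

lemma emod_mem_Icc (hB : 2 ≤ B) (m : ℤ) : m % B ∈ Icc 0 (B - 1) :=
  ⟨Int.emod_nonneg _ (by omega), by have := Int.emod_lt_of_pos m (by omega : 0 < B); omega⟩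

lemma exists_eq_iterate (hT : IsTile A B T) (hB : 2 ≤ B) (n : ℕ) {t : Fin 2 → ℝ} (ht : t ∈ T)
    (z : Fin 2 → ℤ) : ∃ t' ∈ T,
      (mulR A B)^[n] (t' + toPlane ((quot A B)^[n] z)) = t + toPlane z := by
  induction n generalizing t z with
  | zero => exact ⟨t, ht, rfl⟩
  | succ n ih =>
    obtain ⟨t₁, ht₁, h₁⟩ := hT.exists_mulR_eq ht (emod_mem_Icc hB (z 0))
    obtain ⟨t', ht', h⟩ := ih ht₁ (quot A B z)
    refine ⟨t', ht', ?_⟩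
    rw [Function.iterate_succ_apply', Function.iterate_succ_apply, h, map_add, h₁, mulR_toPlane,
      add_assoc, ← map_add, add_comm (_ • _), mulZ_quot]

lemma isClosed_image_toPlane (S : Set (Fin 2 → ℤ)) : IsClosed (toPlane '' S) := by
  refine Metric.isClosed_of_pairwise_le_dist (ε := 1) one_pos ?_
  rintro _ ⟨z, -, rfl⟩ _ ⟨w, -, rfl⟩ hne
  obtain ⟨i, hi⟩ : ∃ i, z i ≠ w i := by
    by_contra! h
    exact hne (congrArg _ (funext h))
  refine le_trans ?_ (dist_le_pi_dist _ _ i)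
  rw [toPlane_apply, toPlane_apply, Int.dist_cast_real]
  exact Int.pairwise_one_le_dist hi

lemma isClosed_translates (hTc : IsCompact T) (S : Set (Fin 2 → ℤ)) :
    IsClosed {x | ∃ k ∈ S, ∃ t ∈ T, x = t + toPlane k} := by
  convert (isClosed_image_toPlane S).add_left_of_isCompact hTc using 1
  ext x
  simp only [mem_ofPred_eq, mem_add, mem_image, exists_exists_and_eq_and]
  constructor
  · rintro ⟨k, hk, t, ht, rfl⟩
    exact ⟨t, ht, k, hk, rfl⟩
  · rintro ⟨t, ht, k, hk, rfl⟩
    exact ⟨k, hk, t, ht, rfl⟩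

variable {q : Seminorm ℝ (Fin 2 → ℝ)} {c C : ℝ}

lemma exists_eq_add (hT : IsTile A B T) (hB : 2 ≤ B) (hTne : T.Nonempty) (hTc : IsCompact T)
    (h : IsAdapted A B q c C) (x : Fin 2 → ℝ) : ∃ k, ∃ t ∈ T, x = t + toPlane k := by
  obtain ⟨t, ht⟩ := hTne
  suffices x ∈ {x | ∃ k ∈ univ, ∃ t ∈ T, x = t + toPlane k} by simpa using this
  refine h.mem_of_isClosed (isClosed_translates hTc univ) (C * 1 + q t) fun n => ?_
  set w := (mulR A B)^[n] x with hw
  let z : Fin 2 → ℤ := fun i => ⌊w i⌋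
  obtain ⟨t', ht', he⟩ := hT.exists_eq_iterate hB n ht z
  refine ⟨t' + toPlane ((quot A B)^[n] z), ⟨_, trivial, t', ht', rfl⟩,
    (h.sub_le_iterate n _ _).trans ?_⟩
  rw [he, ← hw]
  refine mul_le_mul_of_nonneg_left ?_ (pow_nonneg h.c_nonneg n)
  have h1 : ‖w - toPlane z‖ ≤ 1 := by
    rw [pi_norm_le_iff_of_nonneg zero_le_one]
    intro i
    rw [Pi.sub_apply, toPlane_apply, Real.norm_eq_abs, abs_le]
    have h1 := Int.floor_le (w i)
    have h2 := (Int.lt_floor_add_one (w i)).le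
    constructor <;> simp only [z] <;> linarith
  calc q (w - (t + toPlane z)) = q ((w - toPlane z) - t) := by congr 1; abel
    _ ≤ q (w - toPlane z) + q t := map_sub_le_add q _ _
    _ ≤ C * 1 + q t := by
      gcongr
      exact (h.le_norm _).trans (mul_le_mul_of_nonneg_left h1 h.C_pos.le)

lemma exists_ne_zero_of_mem_frontier (hT : IsTile A B T) (hB : 2 ≤ B) (hTne : T.Nonempty)
    (hTc : IsCompact T) (h : IsAdapted A B q c C) {x : Fin 2 → ℝ} (hx : x ∈ frontier T) :
    ∃ k ≠ 0, ∃ t ∈ T, x = t + toPlane k := by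
  by_contra hcon
  have hopen := (isClosed_translates hTc {k | k ≠ 0}).isOpen_compl
  refine hx.2 (mem_interior.mpr ⟨_, fun y hy => ?_, hopen, hcon⟩)
  obtain ⟨k, t, ht, rfl⟩ := hT.exists_eq_add hB hTne hTc h y
  by_cases hk : k = 0
  · simpa [hk] using ht
  · exact absurd ⟨k, hk, t, ht, rfl⟩ hy

end IsTile

/-- A lattice step `p → p + r` across the boundary of the `n`-th approximation of the tile
carries a scaled copy of `K_r` into `K_k`. -/
lemma exists_iterate_mem (hA : 1 ≤ A) (hAB : A ≤ B) (hB : 2 ≤ B)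
    {K : ↥(nbrSet A) → Set (Fin 2 → ℝ)} (hK : ∀ s, hutch A B K s ⊆ K s) (n : ℕ)
    {p r k : Fin 2 → ℤ} (hr : r ∈ nbrSet A) (hp : (quot A B)^[n] p = 0)
    (hpr : (quot A B)^[n] (p + r) = k) (hk : k ≠ 0) :
    ∃ hk : k ∈ nbrSet A, ∀ y ∈ K ⟨r, hr⟩, ∃ x ∈ K ⟨k, hk⟩,
      (mulR A B)^[n] x = y + toPlane p := by
  induction n generalizing p r with
  | zero =>
    obtain rfl : p = 0 := hp
    obtain rfl : r = k := by simpa using hpr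
    exact ⟨hr, fun y hy => ⟨y, hy, by simp⟩⟩
  | succ n ih =>
    rw [Function.iterate_succ_apply] at hp hpr
    set s := quot A B (p + r) - quot A B p with hs
    have hE : Edge A B s r (p 0 % B) := by
      refine ⟨IsTile.emod_mem_Icc hB _, (p + r) 0 % B, IsTile.emod_mem_Icc hB _, ?_⟩
      have h1 := mulZ_quot (A := A) (B := B) p
      have h2 := mulZ_quot (A := A) (B := B) (p + r)
      rw [hs, mulZ_sub, sub_add_eq_add_sub, h2, sub_eq_iff_eq_add, add_assoc,
        add_comm ((p 0 % B) • _), h1, add_comm]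
    have hs0 : s ≠ 0 := by
      intro h0
      rw [sub_eq_zero.mp h0, hp] at hpr
      exact hk hpr.symm
    have hsR := mem_nbrSet_of_edge hA hAB hr hE hs0
    obtain ⟨hkR, hx⟩ := ih hsR hp (by rwa [hs, add_sub_cancel])
    refine ⟨hkR, fun y hy => ?_⟩
    obtain ⟨w, hw⟩ := mulR_surjective (A := A) hB (y + ((p 0 % B : ℤ) : ℝ) • e1)
    obtain ⟨x, hxK, hxe⟩ := hx w (hK _ ⟨⟨r, hr⟩, _, hE, by rwa [hw, add_sub_cancel_right]⟩)
    refine ⟨x, hxK, ?_⟩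
    rw [Function.iterate_succ_apply', hxe, map_add, hw, mulR_toPlane, ← toPlane_e1, add_assoc,
      ← map_add, add_comm (_ • _), mulZ_quot]

/-- Every displacement can be realised by a path with steps in `R` that stays within a distance
depending on the displacement only. -/
lemma exists_crossing (A : ℤ) (w : Fin 2 → ℤ) :
    ∃ D : ℝ, ∀ (P : (Fin 2 → ℤ) → Prop) (p : Fin 2 → ℤ), P p → ¬ P (p + w) →
      ∃ u : Fin 2 → ℤ, ‖u‖ ≤ D ∧ ∃ r ∈ nbrSet A, P (p + u) ∧ ¬ P (p + u + r) := by
  have hw : w ∈ AddSubmonoid.closure (nbrSet A) := by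
    have hnat : ∀ r ∈ nbrSet A, ∀ m : ℤ, m • r ∈ AddSubmonoid.closure (nbrSet A) := by
      intro r hr m
      obtain ⟨m, rfl | rfl⟩ := m.eq_nat_or_neg
      · rw [natCast_zsmul]
        exact AddSubmonoid.nsmul_mem _ (AddSubmonoid.subset_closure hr) _
      · rw [neg_smul, ← smul_neg, natCast_zsmul]
        exact AddSubmonoid.nsmul_mem _ (AddSubmonoid.subset_closure (neg_mem_nbrSet hr)) _
    have : w = (w 0 - (A - 1) * w 1) • ![1, 0] + w 1 • ![A - 1, 1] := by
      ext i; fin_cases i <;> simp; ring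
    rw [this]
    exact AddSubmonoid.add_mem _ (hnat _ (by simp [nbrSet]) _) (hnat _ (by simp [nbrSet]) _)
  induction hw using AddSubmonoid.closure_induction with
  | mem r hr => exact ⟨0, fun P p hp hpr => ⟨0, by simp, r, hr, by simpa using hp, by simpa using hpr⟩⟩
  | zero => exact ⟨0, fun P p hp hpr => absurd hp (by simpa using hpr)⟩
  | add v w _ _ ihv ihw =>
    obtain ⟨D, hD⟩ := ihv
    obtain ⟨E, hE⟩ := ihw
    refine ⟨max D (‖v‖ + E), fun P p hp hpr => ?_⟩
    by_cases hpv : P (p + v)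
    · obtain ⟨u, hu, r, hr, h1, h2⟩ := hE P (p + v) hpv (by rwa [add_assoc])
      refine ⟨v + u, ((norm_add_le _ _).trans (by gcongr)).trans (le_max_right _ _), r, hr, ?_, ?_⟩
      · rwa [← add_assoc]
      · rwa [← add_assoc]
    · obtain ⟨u, hu, h⟩ := hD P p hp hpv
      exact ⟨u, hu.trans (le_max_left _ _), h⟩

lemma norm_toPlane (z : Fin 2 → ℤ) : ‖toPlane z‖ = ‖z‖ := by
  simp [Pi.norm_def, nnnorm, Int.norm_eq_abs]

lemma exists_crossing_uniform (A : ℤ) (H : ℝ) :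
    ∃ D : ℝ, ∀ w : Fin 2 → ℤ, ‖w‖ ≤ H → ∀ (P : (Fin 2 → ℤ) → Prop) (p : Fin 2 → ℤ),
      P p → ¬ P (p + w) →
      ∃ u : Fin 2 → ℤ, ‖u‖ ≤ D ∧ ∃ r ∈ nbrSet A, P (p + u) ∧ ¬ P (p + u + r) := by
  choose D hD using exists_crossing A
  have hfin : {w : Fin 2 → ℤ | ‖w‖ ≤ H}.Finite := by
    simpa [Metric.closedBall, dist_zero_right] using
      (isCompact_closedBall (0 : Fin 2 → ℤ) H).finite_of_discrete
  obtain ⟨E, hE⟩ := (hfin.image D).bddAbove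
  refine ⟨E, fun w hw P p hp hpw => ?_⟩
  obtain ⟨u, hu, h⟩ := hD w P p hp hpw
  exact ⟨u, hu.trans (hE (mem_image_of_mem D hw)), h⟩

lemma IsTile.frontier_subset {T : Set (Fin 2 → ℝ)} {q : Seminorm ℝ (Fin 2 → ℝ)} {c C : ℝ}
    (hT : IsTile A B T) (hA : 1 ≤ A) (hAB : A ≤ B) (hB : 2 ≤ B) (hTne : T.Nonempty)
    (hTc : IsCompact T) (h : IsAdapted A B q c C) {K : ↥(nbrSet A) → Set (Fin 2 → ℝ)}
    (hK : bdryGIFS A B K) : frontier T ⊆ ⋃ s, K s := by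
  rw [bdryGIFS_iff hB] at hK
  intro x hx
  obtain ⟨k, hk, t, ht, hxt⟩ := hT.exists_ne_zero_of_mem_frontier hB hTne hTc h hx
  have hxT : x ∈ T := hTc.isClosed.frontier_subset hx
  obtain ⟨R, hR⟩ := hTc.isBounded.exists_norm_le
  obtain ⟨D, hD⟩ := exists_crossing_uniform A (R + R)
  have hKb : Bornology.IsBounded (⋃ s, K s) :=
    Bornology.isBounded_iUnion.mpr fun s => (hK s).2.1.isBounded
  obtain ⟨E, hE0, hE⟩ := h.exists_bound hKb
  refine h.mem_of_isClosed (isClosed_iUnion_of_finite fun s => (hK s).2.1.isClosed)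
    (C * R + (E + C * D)) fun n => ?_
  obtain ⟨p, hp, t₁, ht₁, he₁⟩ := hT.exists_iterate_eq hxT 0 n
  obtain ⟨p', hp', t₂, ht₂, he₂⟩ := hT.exists_iterate_eq ht k n
  rw [map_zero, add_zero] at he₁
  rw [← hxt, he₁] at he₂
  have hpp : ‖p' - p‖ ≤ R + R := by
    have : toPlane (p' - p) = t₁ - t₂ := by
      rw [map_sub, sub_eq_sub_iff_add_eq_add, add_comm, ← he₂]
    rw [← norm_toPlane, this]
    exact (norm_sub_le _ _).trans (add_le_add (hR _ ht₁) (hR _ ht₂))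
  obtain ⟨u, hu, r, hr, h1, h2⟩ := hD (p' - p) hpp (fun z => (quot A B)^[n] z = 0) p hp
    (by rwa [add_sub_cancel, hp'])
  obtain ⟨hkR, hkK⟩ := exists_iterate_mem hA hAB hB (fun s => (hK s).2.2.superset) n hr h1 rfl h2
  obtain ⟨y, hy⟩ := (hK ⟨r, hr⟩).1
  obtain ⟨v, hv, hve⟩ := hkK y hy
  refine ⟨v, mem_iUnion_of_mem _ hv, (h.sub_le_iterate n x v).trans ?_⟩
  refine mul_le_mul_of_nonneg_left ?_ (pow_nonneg h.c_nonneg n)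
  have hC := h.C_pos.le
  calc q ((mulR A B)^[n] x - (mulR A B)^[n] v) = q (t₁ - (y + toPlane u)) := by
        rw [he₁, hve, map_add]; congr 1; abel
    _ ≤ q t₁ + (q y + q (toPlane u)) :=
      (map_sub_le_add q _ _).trans (add_le_add le_rfl (map_add_le_add q _ _))
    _ ≤ C * R + (E + C * D) := by
      gcongr
      · exact (h.le_norm _).trans (mul_le_mul_of_nonneg_left (hR _ ht₁) hC)
      · exact hE _ (mem_iUnion_of_mem _ hy)
      · exact (h.le_norm _).trans (mul_le_mul_of_nonneg_left (by rwa [norm_toPlane]) hC)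

open MeasureTheory

namespace IsTile

variable {T : Set (Fin 2 → ℝ)}

lemma volume_translate (S : Set (Fin 2 → ℝ)) (v : Fin 2 → ℝ) :
    volume ((fun x => x + v) '' S) = volume S := by
  rw [image_add_right, measure_preimage_add_right]

lemma volume_image_mulR (hB : 2 ≤ B) (S : Set (Fin 2 → ℝ)) :
    volume (mulR A B '' S) = ENNReal.ofReal B * volume S := by
  rw [Measure.addHaar_image_linearMap, det_mulR,
    abs_of_nonneg (by exact_mod_cast (by omega : 0 ≤ B))]

lemma volume_ne_zero (hT : IsTile A B T) (hB : 2 ≤ B) (hTne : T.Nonempty) (hTc : IsCompact T)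
    {q : Seminorm ℝ (Fin 2 → ℝ)} {c C : ℝ} (h : IsAdapted A B q c C) : volume T ≠ 0 := by
  intro h0
  have : (univ : Set (Fin 2 → ℝ)) = ⋃ k : Fin 2 → ℤ, (fun x => x + toPlane k) '' T := by
    refine (eq_univ_of_forall fun x => ?_).symm
    obtain ⟨k, t, ht, rfl⟩ := hT.exists_eq_add hB hTne hTc h x
    exact mem_iUnion_of_mem k ⟨t, ht, rfl⟩
  have hnull : volume (univ : Set (Fin 2 → ℝ)) = 0 := by
    rw [this, measure_iUnion_null_iff]
    intro k
    rw [volume_translate, h0]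
  exact NeZero.ne (volume : Measure (Fin 2 → ℝ)) (Measure.measure_univ_eq_zero.mp hnull)

/-- The overlap `T ∩ (T + z)`. -/
def overlap (T : Set (Fin 2 → ℝ)) (z : Fin 2 → ℤ) : Set (Fin 2 → ℝ) :=
  T ∩ (fun x => x + toPlane z) '' T

lemma volume_overlap_neg {z : Fin 2 → ℤ} (h : volume (overlap T z) = 0) :
    volume (overlap T (-z)) = 0 := by
  rw [← volume_translate _ (toPlane z)]
  refine measure_mono_null ?_ h
  rintro _ ⟨x, ⟨hx, t, ht, rfl⟩, rfl⟩
  exact ⟨by simpa using ht, _, hx, rfl⟩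

lemma volume_overlap_e1 (hT : IsTile A B T) (hB : 2 ≤ B) (hTc : IsCompact T) :
    volume (overlap T ![1, 0]) = 0 := by
  obtain ⟨b, rfl⟩ : ∃ b : ℕ, B = b + 1 := ⟨(B - 1).toNat, by omega⟩
  set S := (fun x => x + toPlane ![1, 0]) '' T with hS
  set W := ⋃ j ∈ Finset.Icc (1 : ℤ) b, (fun x => x + (j : ℝ) • e1) '' T with hW
  have hSm : MeasurableSet S := (hTc.image (by fun_prop)).isClosed.measurableSet
  have hSW : S ⊆ W := by
    have h1 : toPlane ![1, 0] = ((1 : ℤ) : ℝ) • e1 := by rw [← toPlane_e1, one_smul]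
    rw [hS, h1]
    exact subset_biUnion_of_mem (u := fun j : ℤ => (fun x => x + (j : ℝ) • e1) '' T)
      (Finset.mem_coe.mpr (Finset.mem_Icc.mpr ⟨le_rfl, by omega⟩))
  have hWv : volume W ≤ b * volume T := by
    refine (measure_biUnion_finset_le _ _).trans ?_
    simp only [volume_translate, Finset.sum_const, Int.card_Icc, nsmul_eq_mul]
    simp
  have hsub : mulR A (b + 1) '' T ⊆ W ∪ (T \ S) := by
    rw [hT]
    refine iUnion₂_subset fun j hj => ?_
    rcases hj.1.eq_or_lt with rfl | hj0
    · rintro _ ⟨t, ht, rfl⟩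
      by_cases h : t ∈ S
      · exact .inl (by simpa using hSW h)
      · exact .inr (by simpa using And.intro ht h)
    · refine subset_union_of_subset_left ?_ _
      have := hj.2
      exact subset_biUnion_of_mem (u := fun j : ℤ => (fun x => x + (j : ℝ) • e1) '' T)
        (Finset.mem_coe.mpr (Finset.mem_Icc.mpr ⟨by omega, by omega⟩))
  have hv := volume_image_mulR (A := A) hB T
  have hcast : ENNReal.ofReal (((b : ℤ) + 1 : ℤ) : ℝ) = b + 1 := by
    rw [show (((b : ℤ) + 1 : ℤ) : ℝ) = ((b + 1 : ℕ) : ℝ) by push_cast; rfl, ENNReal.ofReal_natCast]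
    push_cast; rfl
  have hfin : (b + 1) * volume T ≠ ⊤ := ENNReal.mul_ne_top (by finiteness) hTc.measure_lt_top.ne
  have hle : (b + 1) * volume T + volume (T ∩ S) ≤ (b + 1) * volume T + 0 := by
    calc (b + 1) * volume T + volume (T ∩ S) ≤ (b * volume T + volume (T \ S)) + volume (T ∩ S) := by
          rw [← hcast, ← hv]
          gcongr
          exact (measure_mono hsub).trans ((measure_union_le _ _).trans (by gcongr))
      _ = b * volume T + volume T := by
          rw [add_assoc, add_comm (volume (T \ S)), measure_inter_add_sdiff _ hSm]
      _ = (b + 1) * volume T + 0 := by ring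
  exact le_zero_iff.mp ((ENNReal.add_le_add_iff_left hfin).mp hle)

lemma volume_overlap_of_edge (hT : IsTile A B T) (hB : 2 ≤ B) {s s' : Fin 2 → ℤ} {a : ℤ}
    (hE : Edge A B s s' a) (hs : volume (overlap T s) = 0) : volume (overlap T s') = 0 := by
  obtain ⟨ha, a', ha', he⟩ := hE
  have h0 : volume (mulR A B '' overlap T s) = 0 := by rw [volume_image_mulR hB, hs, mul_zero]
  rw [← volume_translate _ (toPlane (a • ![1, 0]))]
  refine measure_mono_null ?_ h0
  rintro _ ⟨_, ⟨hx, t, ht, rfl⟩, rfl⟩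
  obtain ⟨x', hx', hxe⟩ := hT.exists_mulR_eq hx ha
  obtain ⟨t', ht', hte⟩ := hT.exists_mulR_eq ht ha'
  refine ⟨x', ⟨hx', t', ht', mulR_injective (A := A) hB ?_⟩, hxe⟩
  dsimp only at hxe ⊢
  rw [map_add, hte, hxe, mulR_toPlane, add_assoc, add_assoc, ← map_add, ← map_add, ← he,
    add_comm (mulZ A B s)]

lemma volume_overlap (hT : IsTile A B T) (hA : 1 ≤ A) (hAB : A ≤ B) (hB : 2 ≤ B)
    (hTc : IsCompact T) {s : Fin 2 → ℤ} (hs : s ∈ nbrSet A) : volume (overlap T s) = 0 := by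
  have h1 := hT.volume_overlap_e1 hB hTc
  have h2 : volume (overlap T ![A - 1, 1]) = 0 := by
    refine hT.volume_overlap_of_edge hB (s := ![1, 0]) (a := 0) ⟨?_, A - 1, ?_, ?_⟩ h1 <;>
      simp [mulZ] <;> omega
  have h3 : volume (overlap T ![-A, -1]) = 0 := by
    refine hT.volume_overlap_of_edge hB (s := ![A - 1, 1]) (a := 0) ⟨?_, B - A, ?_, ?_⟩ h2 <;>
      simp [mulZ] <;> omega
  have h1' := volume_overlap_neg h1
  have h2' := volume_overlap_neg h2
  have h3' := volume_overlap_neg h3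
  simp only [nbrSet, mem_insert_iff, mem_singleton_iff] at hs
  rcases hs with rfl | rfl | rfl | rfl | rfl | rfl
  · exact h1
  · simpa using h1'
  · exact h2
  · simpa [neg_add_eq_sub] using h2'
  · simpa using h3'
  · exact h3

lemma notMem_interior (hT : IsTile A B T) (hB : 2 ≤ B) (hTne : T.Nonempty) (hTc : IsCompact T)
    {q : Seminorm ℝ (Fin 2 → ℝ)} {c C : ℝ} (h : IsAdapted A B q c C) {s : Fin 2 → ℤ}
    (hs : volume (overlap T s) = 0) {t : Fin 2 → ℝ} (ht : t ∈ T) :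
    t + toPlane s ∉ interior T := by
  intro hx
  obtain ⟨ε, hε, hball⟩ := Metric.isOpen_iff.mp isOpen_interior _ hx
  obtain ⟨D, hD0, hD⟩ := h.exists_bound hTc.isBounded
  obtain ⟨n, hn⟩ := h.exists_pow_lt (D + D) hε
  obtain ⟨z, hz, t₁, ht₁, he₁⟩ := hT.exists_iterate_eq ht s n
  have hpre : (fun x => x + toPlane z) '' T ⊆ (mulR A B)^[n] '' overlap T s := by
    rintro _ ⟨t₂, ht₂, rfl⟩
    obtain ⟨t', ht', he'⟩ := hT.exists_eq_iterate hB n ht₂ z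
    rw [hz] at he'
    refine ⟨t' + toPlane s, ⟨interior_subset (hball ?_), t', ht', rfl⟩, he'⟩
    rw [Metric.mem_ball, dist_eq_norm]
    refine (h.norm_le _).trans_lt (lt_of_le_of_lt ?_ hn)
    refine mul_le_mul_of_nonneg_left ((h.sub_le_iterate n _ _).trans ?_) h.C_pos.le
    refine mul_le_mul_of_nonneg_left ?_ (pow_nonneg h.c_nonneg n)
    rw [he', he₁, add_sub_add_right_eq_sub]
    exact (map_sub_le_add q _ _).trans (add_le_add (hD _ ht₂) (hD _ ht₁))
  have hnull : ∀ n : ℕ, volume ((mulR A B)^[n] '' overlap T s) = 0 := by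
    intro n
    induction n with
    | zero => simpa using hs
    | succ n ih => rw [Function.iterate_succ', image_comp, volume_image_mulR hB, ih, mul_zero]
  refine hT.volume_ne_zero hB hTne hTc h ?_
  rw [← volume_translate T (toPlane z)]
  exact measure_mono_null hpre (hnull n)

lemma subset_frontier (hT : IsTile A B T) (hA : 1 ≤ A) (hAB : A ≤ B) (hB : 2 ≤ B)
    (hTne : T.Nonempty) (hTc : IsCompact T) {q : Seminorm ℝ (Fin 2 → ℝ)} {c C : ℝ}
    (h : IsAdapted A B q c C) {K : ↥(nbrSet A) → Set (Fin 2 → ℝ)} (hK : bdryGIFS A B K)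
    (s : ↥(nbrSet A)) : K s ⊆ frontier T := by
  rw [bdryGIFS_iff hB] at hK
  have hpost := fun s => (hK s).2.2.subset
  have hbdd := fun s => (hK s).2.1.isBounded
  have h1 : K s ⊆ T := by
    refine h.subset_of_hutch hB (Y := fun _ => T) hpost ?_ hbdd (fun _ => hTne)
      (fun _ => hTc.isClosed) s
    rintro s x ⟨s', a, hE, hx⟩
    obtain ⟨t, ht, he⟩ := hT.exists_mulR_eq hx hE.1
    rw [toPlane_e1, sub_add_cancel] at he
    rwa [← mulR_injective hB he]
  have h2 : K s ⊆ (fun x => x + toPlane s) '' T := by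
    refine h.subset_of_hutch hB (Y := fun s => (fun x => x + toPlane s) '' T) hpost ?_ hbdd
      (fun _ => hTne.image _) (fun _ => (hTc.image (by fun_prop)).isClosed) s
    rintro s x ⟨s', a, ⟨-, a', ha', hE⟩, t, ht, hte⟩
    obtain ⟨t', ht', he⟩ := hT.exists_mulR_eq ht ha'
    refine ⟨t', ht', mulR_injective (A := A) hB ?_⟩
    dsimp only at hte ⊢
    rw [eq_sub_iff_add_eq, ← toPlane_e1, add_assoc, ← map_add, ← hE] at hte
    rw [map_add, he, mulR_toPlane, ← hte, add_assoc, ← map_add, add_comm (a' • _)]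
  intro x hx
  refine ⟨subset_closure (h1 hx), ?_⟩
  obtain ⟨t, ht, rfl⟩ := h2 hx
  exact hT.notMem_interior hB hTne hTc h (hT.volume_overlap hA hAB hB hTc s.2) ht

end IsTile

end CNSTile

/-- There is a unique family `(K_s)_{s ∈ R}` of nonempty compact
sets satisfying the boundary GIFS equations, and the boundary of the tile `T`
is `∂T = ⋃_{s ∈ R} K_s`. -/
theorem boundary_GIFS
    (A B : ℤ) (hA : 1 ≤ A) (hAB : A ≤ B) (hB : 2 ≤ B)
    (T : Set (Fin 2 → ℝ)) (hTne : T.Nonempty) (hTcp : IsCompact T)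
    (hT : (M' A B).mulVec '' T =
      ⋃ j ∈ Set.Icc (0 : ℤ) (B - 1), (fun x => x + (j : ℝ) • e1) '' T) :
    (∃! K : ↥(nbrSet A) → Set (Fin 2 → ℝ), bdryGIFS A B K) ∧
    (∀ K : ↥(nbrSet A) → Set (Fin 2 → ℝ), bdryGIFS A B K →
      frontier T = ⋃ s : ↥(nbrSet A), K s) := by
  obtain ⟨q, c, C, h⟩ := CNSTile.exists_isAdapted hA hAB hB
  have hT' : CNSTile.IsTile A B T := hT
  refine ⟨?_, fun K hK => ?_⟩
  · obtain ⟨K, hK⟩ := h.exists_solution hA hAB hB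
    exact ⟨K, hK, fun K' hK' => h.unique_solution hB hK' hK⟩
  · exact (hT'.frontier_subset hA hAB hB hTne hTcp h hK).antisymm
      (Set.iUnion_subset fun s => hT'.subset_frontier hA hAB hB hTne hTcp h hK s)
end
end
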